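/- arXiv:1505.06742 — 8 statements merged into one kernel-verified Lean document; each statement's English description precedes it below -/
import Mathlib

section
/- A positive integer h divides 24 if and only if every unit x of ℤ/hℤ satisfies x² = 1; equivalently, h ∣ 24 if and only if for all integers x, y with xy ≡ 1 (mod h) one has x ≡ y (mod h). -/
/-- The property that all units of `ZMod n` square to `1` passes to divisors of `n`. -/
theorem ZMod.units_sq_eq_one_of_dvd {m n : ℕ} [NeZero n] (hmn : m ∣ n)
    (hn : ∀ x : (ZMod n)ˣ, x ^ 2 = 1) (x : (ZMod m)ˣ) : x ^ 2 = 1 := by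
  obtain ⟨u, rfl⟩ := ZMod.unitsMap_surjective hmn x
  rw [← map_pow, hn, map_one]

theorem ZMod.dvd_24_of_units_sq_eq_one {h : ℕ} [NeZero h] (hx : ∀ x : (ZMod h)ˣ, x ^ 2 = 1) :
    h ∣ 24 := by
  rcases Nat.coprime_or_dvd_of_prime Nat.prime_five h with h5 | h5
  · have h25 := congrArg Units.val (hx (ZMod.unitOfCoprime 5 h5))
    rw [Units.val_pow_eq_pow_val, ZMod.coe_unitOfCoprime, Units.val_one] at h25
    rw [← ZMod.natCast_eq_zero_iff]
    push_cast at h25 ⊢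
    linear_combination h25
  · have h2 := ZMod.units_sq_eq_one_of_dvd h5 hx (ZMod.unitOfCoprime 2 (by norm_num))
    exact absurd (congrArg Units.val h2) (by decide)

/-- In a commutative monoid, all units square to `1` iff every unit is its own inverse. -/
theorem units_sq_eq_one_iff_forall_mul_eq_one {M : Type*} [CommMonoid M] :
    (∀ x : Mˣ, x ^ 2 = 1) ↔ ∀ a b : M, a * b = 1 → a = b := by
  constructor
  · intro hx a b hab
    have hu := hx (Units.mkOfMulEqOne a b hab)
    rw [sq, mul_eq_one_iff_eq_inv] at hu
    exact congrArg Units.val hu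
  · intro hM x
    rw [sq, mul_eq_one_iff_eq_inv]
    exact Units.ext (hM _ _ x.mul_inv)

theorem ZMod.forall_mul_eq_one_iff_int (h : ℕ) :
    (∀ a b : ZMod h, a * b = 1 → a = b) ↔
      ∀ x y : ℤ, x * y ≡ 1 [ZMOD (h : ℤ)] → x ≡ y [ZMOD (h : ℤ)] := by
  simp only [ZMod.intCast_surjective.forall, ← ZMod.intCast_eq_intCast_iff, Int.cast_mul,
    Int.cast_one]

theorem ZMod.dvd_24_iff_forall_units_sq_eq_one {h : ℕ} [NeZero h] :
    h ∣ 24 ↔ ∀ x : (ZMod h)ˣ, x ^ 2 = 1 := by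
  refine ⟨fun h24 => ZMod.units_sq_eq_one_of_dvd h24 ?_, ZMod.dvd_24_of_units_sq_eq_one⟩
  rw [units_sq_eq_one_iff_forall_mul_eq_one]
  decide

/-- A positive integer `h` divides `24` if and only if every unit of `ℤ/hℤ` squares to `1`;
equivalently, `h ∣ 24` iff for all integers `x, y` with `x·y ≡ 1 (mod h)` one has
`x ≡ y (mod h)`. -/
theorem dvd_24_iff_units_sq_eq_one (h : ℕ) (hh : 0 < h) :
    (h ∣ 24 ↔ ∀ x : (ZMod h)ˣ, x ^ 2 = 1) ∧
    (h ∣ 24 ↔ ∀ x y : ℤ, x * y ≡ 1 [ZMOD (h : ℤ)] → x ≡ y [ZMOD (h : ℤ)]) := by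
  have : NeZero h := ⟨hh.ne'⟩
  rw [← ZMod.forall_mul_eq_one_iff_int, ← units_sq_eq_one_iff_forall_mul_eq_one, and_self]
  exact ZMod.dvd_24_iff_forall_units_sq_eq_one
end

section
/- The (2,3,3) triangle group is the alternating group A₄: the group presented by three generators R, S, T subject to the relations R·S·T = 1, R² = 1, S³ = 1, T³ = 1 is isomorphic to the alternating group on 4 letters, and in particular has order 12. -/
/-- The relators `RST`, `R²`, `S³`, `T³` of the `(2,3,3)` triangle group, where
`R`, `S`, `T` are the three generators of the free group on `Fin 3`. -/
def triangleRels233 : Set (FreeGroup (Fin 3)) :=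
  { FreeGroup.of 0 * FreeGroup.of 1 * FreeGroup.of 2,
    FreeGroup.of 0 ^ 2, FreeGroup.of 1 ^ 3, FreeGroup.of 2 ^ 3 }

/-- The words `v * s ^ j` with `v ∈ {1, r, s r s⁻¹, s⁻¹ r s}` and `j < 3`, which exhaust a quotient
of the `(2,3,3)` triangle group. -/
def triangleWord {G : Type*} [Group G] (r s : G) (p : Fin 4 × Fin 3) : G :=
  ![1, r, s * r * s⁻¹, s⁻¹ * r * s] p.1 * s ^ (p.2 : ℕ)

theorem map_triangleWord {G H : Type*} [Group G] [Group H] (f : G →* H) (r s : G)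
    (p : Fin 4 × Fin 3) : f (triangleWord r s p) = triangleWord (f r) (f s) p := by
  obtain ⟨i, j⟩ := p
  fin_cases i <;> simp [triangleWord]

theorem mul_triangleWord_of_order_three {G : Type*} [Group G] (r : G) {s : G} (hs : s ^ 3 = 1)
    (p : Fin 4 × Fin 3) :
    s * triangleWord r s p = triangleWord r s (![0, 2, 3, 1] p.1, p.2 + 1) := by
  obtain ⟨i, j⟩ := p
  have hj : s ^ ((j + 1 : Fin 3) : ℕ) = s * s ^ (j : ℕ) := by
    fin_cases j
    · simp
    · simp [pow_two]
    · simpa [pow_succ'] using hs.symm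
  have hinv : s⁻¹ = s * s := inv_eq_of_mul_eq_one_right (by simpa [pow_succ'] using hs)
  have hsss (x : G) : s * (s * (s * x)) = x := by
    rw [← mul_assoc s s, ← hinv, inv_mul_cancel_left]
  fin_cases i <;> simp [triangleWord, hj, hinv, mul_assoc, hsss]

theorem mul_triangleWord_of_order_two {G : Type*} [Group G] {r s : G} (hr : r ^ 2 = 1)
    (hs : s ^ 3 = 1) (hrs : (r * s) ^ 3 = 1) (p : Fin 4 × Fin 3) :
    r * triangleWord r s p = triangleWord r s (![1, 0, 3, 2] p.1, p.2) := by
  obtain ⟨i, j⟩ := p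
  have hrr : r * r = 1 := by rw [← pow_two, hr]
  have hinv : s⁻¹ = s * s := inv_eq_of_mul_eq_one_right (by simpa [pow_succ'] using hs)
  have hconj : r * (s * r * s⁻¹) = s⁻¹ * r * s := by
    have hinv' : (s⁻¹ * r * s)⁻¹ = s⁻¹ * r * s := by
      simp [mul_assoc, inv_eq_of_mul_eq_one_right hrr]
    rw [← hinv', eq_inv_iff_mul_eq_one, ← hrs]
    have hss : s⁻¹ * s⁻¹ = s := by rw [← mul_inv_rev, ← hinv, inv_inv]
    calc r * (s * r * s⁻¹) * (s⁻¹ * r * s) = r * s * r * (s⁻¹ * s⁻¹) * r * s := by group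
      _ = (r * s) ^ 3 := by rw [hss]; simp [pow_succ, mul_assoc]
  fin_cases i
  · simp [triangleWord]
  · simp [triangleWord, ← mul_assoc, hrr]
  · simp [triangleWord, ← hconj, ← mul_assoc]
  · simp [triangleWord, ← hconj, ← mul_assoc, hrr]

/-- A group generated by `r` and `s` with `r² = s³ = (rs)³ = 1` consists of the twelve words
`triangleWord r s`. -/
theorem triangleWord_surjective {G : Type*} [Group G] {r s : G} (hr : r ^ 2 = 1)
    (hs : s ^ 3 = 1) (hrs : (r * s) ^ 3 = 1) (hgen : Subgroup.closure {r, s} = ⊤) :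
    Function.Surjective (triangleWord r s) := by
  intro g
  have hg : g ∈ Subgroup.closure {r, s} := hgen ▸ Subgroup.mem_top g
  have hrinv : r⁻¹ = r := inv_eq_of_mul_eq_one_right (by rw [← pow_two, hr])
  have hsinv : s⁻¹ = s * s := inv_eq_of_mul_eq_one_right (by simpa [pow_succ'] using hs)
  induction hg using Subgroup.closure_induction_left with
  | one => exact ⟨(0, 0), by simp [triangleWord]⟩
  | mul_left x hx y _ ih =>
    obtain ⟨p, rfl⟩ := ih
    obtain rfl | rfl := hx
    · exact ⟨_, (mul_triangleWord_of_order_two hr hs hrs p).symm⟩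
    · exact ⟨_, (mul_triangleWord_of_order_three r hs p).symm⟩
  | inv_mul_cancel x hx y _ ih =>
    obtain ⟨p, rfl⟩ := ih
    obtain rfl | rfl := hx
    · rw [hrinv]
      exact ⟨_, (mul_triangleWord_of_order_two hr hs hrs p).symm⟩
    · rw [hsinv, mul_assoc, mul_triangleWord_of_order_three r hs,
        mul_triangleWord_of_order_three r hs]
      exact ⟨_, rfl⟩

/-- The generators `(0 1)(2 3)`, `(0 1 2)` and the inverse of their product, in `A₄`. -/
def alternatingTriangleGen : Fin 3 → alternatingGroup (Fin 4) :=
  ![⟨Equiv.swap 0 1 * Equiv.swap 2 3, Equiv.Perm.mem_alternatingGroup.2 (by decide)⟩,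
    ⟨Equiv.swap 0 1 * Equiv.swap 1 2, Equiv.Perm.mem_alternatingGroup.2 (by decide)⟩,
    ⟨(Equiv.swap 0 1 * Equiv.swap 2 3 * (Equiv.swap 0 1 * Equiv.swap 1 2))⁻¹, Equiv.Perm.mem_alternatingGroup.2 (by decide)⟩]

theorem lift_alternatingTriangleGen_eq_one :
    ∀ w ∈ triangleRels233, FreeGroup.lift alternatingTriangleGen w = 1 := by
  rintro w (rfl | rfl | rfl | rfl) <;> simp only [map_mul, map_pow, FreeGroup.lift_apply_of] <;>
    decide

theorem triangleWord_alternating_bijective :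
    Function.Bijective
      (triangleWord (alternatingTriangleGen 0) (alternatingTriangleGen 1)) := by
  set_option maxRecDepth 100000 in
  refine (Fintype.bijective_iff_injective_and_card _).2 ⟨by decide, ?_⟩
  rw [card_alternatingGroup]
  decide

theorem triangleWord_presented_surjective :
    Function.Surjective (triangleWord (PresentedGroup.of (rels := triangleRels233) 0)
      (PresentedGroup.of 1)) := by
  have hr : PresentedGroup.of (rels := triangleRels233) 0 ^ 2 = 1 :=
    PresentedGroup.one_of_mem (x := FreeGroup.of 0 ^ 2) (by simp [triangleRels233])
  have hs : PresentedGroup.of (rels := triangleRels233) 1 ^ 3 = 1 :=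
    PresentedGroup.one_of_mem (x := FreeGroup.of 1 ^ 3) (by simp [triangleRels233])
  have ht : PresentedGroup.of (rels := triangleRels233) 2 ^ 3 = 1 :=
    PresentedGroup.one_of_mem (x := FreeGroup.of 2 ^ 3) (by simp [triangleRels233])
  have hrst : PresentedGroup.of (rels := triangleRels233) 0 * PresentedGroup.of 1 *
      PresentedGroup.of 2 = 1 :=
    PresentedGroup.one_of_mem (x := FreeGroup.of 0 * FreeGroup.of 1 * FreeGroup.of 2)
      (by simp [triangleRels233])
  refine triangleWord_surjective hr hs ?_ ?_
  · rw [eq_inv_of_mul_eq_one_left hrst, inv_pow, ht, inv_one]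
  · rw [eq_top_iff, ← PresentedGroup.closure_range_of, Subgroup.closure_le]
    have h0 : PresentedGroup.of (rels := triangleRels233) 0 ∈
        Subgroup.closure {PresentedGroup.of 0, PresentedGroup.of 1} :=
      Subgroup.subset_closure (by simp)
    have h1 : PresentedGroup.of (rels := triangleRels233) 1 ∈
        Subgroup.closure {PresentedGroup.of 0, PresentedGroup.of 1} :=
      Subgroup.subset_closure (by simp)
    rintro _ ⟨i, rfl⟩
    fin_cases i
    · exact h0
    · exact h1
    · exact (eq_inv_of_mul_eq_one_right hrst) ▸ inv_mem (mul_mem h0 h1)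

/-- The `(2,3,3)` triangle group `⟨R,S,T ∣ RST = R² = S³ = T³ = 1⟩` is isomorphic to the
alternating group `A₄`, and in particular has order `12`. -/
theorem triangle_2_3_3_iso_alternating :
    Nonempty (PresentedGroup triangleRels233 ≃* alternatingGroup (Fin 4)) ∧
    Nat.card (PresentedGroup triangleRels233) = 12 := by
  let φ := PresentedGroup.toGroup lift_alternatingTriangleGen_eq_one
  have hφ (p : Fin 4 × Fin 3) : φ (triangleWord (.of 0) (.of 1) p) =
      triangleWord (alternatingTriangleGen 0) (alternatingTriangleGen 1) p := by
    rw [map_triangleWord, PresentedGroup.toGroup.of, PresentedGroup.toGroup.of]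
  have hcard : Nat.card (alternatingGroup (Fin 4)) = 12 := by
    rw [nat_card_alternatingGroup, Nat.card_fin]
    decide
  have hbij : Function.Bijective φ := by
    constructor
    · intro x y hxy
      obtain ⟨p, rfl⟩ := triangleWord_presented_surjective x
      obtain ⟨q, rfl⟩ := triangleWord_presented_surjective y
      rw [hφ, hφ] at hxy
      rw [triangleWord_alternating_bijective.1 hxy]
    · intro g
      obtain ⟨p, rfl⟩ := triangleWord_alternating_bijective.2 g
      exact ⟨_, hφ p⟩
  let e := MulEquiv.ofBijective φ hbij
  exact ⟨⟨e⟩, (Nat.card_congr e.toEquiv).trans hcard⟩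
end

section
/- The (2,3,4) triangle group is the symmetric group S₄: the group presented by three generators R, S, T subject to the relations R·S·T = 1, R² = 1, S³ = 1, T⁴ = 1 is isomorphic to the symmetric group on 4 letters, and in particular has order 24. -/
/-- The relators `RST`, `R²`, `S³`, `T⁴` of the `(2,3,4)` triangle group, where
`R`, `S`, `T` are the three generators of the free group on `Fin 3`. -/
def triangleRels234 : Set (FreeGroup (Fin 3)) :=
  { FreeGroup.of 0 * FreeGroup.of 1 * FreeGroup.of 2,
    FreeGroup.of 0 ^ 2, FreeGroup.of 1 ^ 3, FreeGroup.of 2 ^ 4 }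

/-- In a group with `rst = r² = s³ = t⁴ = 1`, representatives of the left cosets of the
subgroup generated by `t`. -/
def octahedralCosetRep {G : Type*} [Group G] (r s : G) : Fin 6 → G :=
  ![1, s, s ^ 2, r * s ^ 2, s * r * s ^ 2, s ^ 2 * r * s ^ 2]

section

variable {G : Type*} [Group G] {r s t : G}

lemma exists_order_two_mul_octahedralCosetRep (hrst : r * s * t = 1) (hr : r ^ 2 = 1)
    (hs : s ^ 3 = 1) (ht : t ^ 4 = 1) (i : Fin 6) :
    ∃ (j : Fin 6) (k : ℤ), r * octahedralCosetRep r s i = octahedralCosetRep r s j * t ^ k := by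
  have hrr : r * r = 1 := by rw [← sq, hr]
  have htr : t⁻¹ = r * s := inv_eq_of_mul_eq_one_left hrst
  have hst : s * t = r := by
    rw [← inv_eq_of_mul_eq_one_left hrr]
    exact (inv_eq_of_mul_eq_one_right (by rwa [← mul_assoc])).symm
  have key : r * (s ^ 2 * r * s ^ 2) = s * r * s ^ 2 * t := by
    have hsr : (s * r * s * r) * (s * r * s * r) = 1 := by
      have hrs : (r * s) ^ 4 = 1 := by rw [← htr, inv_pow, ht, inv_one]
      calc _ = r⁻¹ * (r * s) ^ 4 * r := by simp [pow_succ, mul_assoc]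
        _ = 1 := by rw [hrs]; group
    calc r * (s ^ 2 * r * s ^ 2) = r * s ^ 2 * r * s ^ 2 * ((s * r * s * r) * (s * r * s * r)) := by
          rw [hsr]; group
      _ = r * s ^ 2 * r * s ^ 3 * r * s * r * (s * r * s * r) := by group
      _ = r * s ^ 2 * (r * r) * s * r * (s * r * s * r) := by rw [hs]; group
      _ = r * s ^ 3 * r * (s * r * s * r) := by rw [hrr]; group
      _ = r * r * (s * r * s * r) := by rw [hs]; group
      _ = s * r * s * (s * t) := by rw [hrr, hst]; group
      _ = s * r * s ^ 2 * t := by simp [pow_succ, mul_assoc]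
  fin_cases i
  · exact ⟨1, 1, by simp [octahedralCosetRep, hst]⟩
  · exact ⟨0, -1, by simp [octahedralCosetRep, htr]⟩
  · exact ⟨3, 0, by simp [octahedralCosetRep]⟩
  · exact ⟨2, 0, by simp [octahedralCosetRep, ← mul_assoc, hrr]⟩
  · refine ⟨5, -1, ?_⟩
    have h := congrArg (r * · * t⁻¹) key
    simp only [← mul_assoc, hrr, one_mul, mul_inv_cancel_right] at h
    simp [octahedralCosetRep, ← mul_assoc, h]
  · exact ⟨4, 1, by simpa [octahedralCosetRep] using key⟩

lemma exists_order_three_mul_octahedralCosetRep (hs : s ^ 3 = 1) (i : Fin 6) :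
    ∃ j : Fin 6, s * octahedralCosetRep r s i = octahedralCosetRep r s j := by
  have hss : s * s ^ 2 = 1 := by rw [← pow_succ', hs]
  refine ⟨![1, 2, 0, 4, 5, 3] i, ?_⟩
  fin_cases i <;> simp [octahedralCosetRep, ← mul_assoc, hss, ← sq]

lemma exists_eq_octahedralCosetRep_mul (hrst : r * s * t = 1) (hr : r ^ 2 = 1)
    (hs : s ^ 3 = 1) (ht : t ^ 4 = 1) (hgen : Subgroup.closure {r, s} = ⊤) (g : G) :
    ∃ (i : Fin 6) (k : ℤ), g = octahedralCosetRep r s i * t ^ k := by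
  have hmulr (y : G) (hy : ∃ (i : Fin 6) (k : ℤ), y = octahedralCosetRep r s i * t ^ k) :
      ∃ (i : Fin 6) (k : ℤ), r * y = octahedralCosetRep r s i * t ^ k := by
    obtain ⟨i, k, rfl⟩ := hy
    obtain ⟨j, l, h⟩ := exists_order_two_mul_octahedralCosetRep hrst hr hs ht i
    exact ⟨j, l + k, by rw [← mul_assoc, h, mul_assoc, zpow_add]⟩
  have hmuls (y : G) (hy : ∃ (i : Fin 6) (k : ℤ), y = octahedralCosetRep r s i * t ^ k) :
      ∃ (i : Fin 6) (k : ℤ), s * y = octahedralCosetRep r s i * t ^ k := by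
    obtain ⟨i, k, rfl⟩ := hy
    obtain ⟨j, h⟩ := exists_order_three_mul_octahedralCosetRep (r := r) hs i
    exact ⟨j, k, by rw [← mul_assoc, h]⟩
  have hrinv : r⁻¹ = r := inv_eq_of_mul_eq_one_left (by rw [← sq, hr])
  have hsinv : s⁻¹ = s * s := inv_eq_of_mul_eq_one_left (by rw [← hs, pow_succ, sq])
  have hg : g ∈ Subgroup.closure {r, s} := hgen ▸ Subgroup.mem_top g
  induction hg using Subgroup.closure_induction_left with
  | one => exact ⟨0, 0, by simp [octahedralCosetRep]⟩
  | mul_left x hx y _ ih =>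
    obtain rfl | rfl := hx
    exacts [hmulr y ih, hmuls y ih]
  | inv_mul_cancel x hx y _ ih =>
    obtain rfl | rfl := hx
    · rw [hrinv]
      exact hmulr y ih
    · rw [hsinv, mul_assoc]
      exact hmuls _ (hmuls y ih)

/-- A group generated by `r` and `s` with `rst = r² = s³ = t⁴ = 1` is covered by `6` cosets of
the powers `1, t, t², t³`. -/
lemma surjective_octahedralCosetRep_mul_pow (hrst : r * s * t = 1) (hr : r ^ 2 = 1)
    (hs : s ^ 3 = 1) (ht : t ^ 4 = 1) (hgen : Subgroup.closure {r, s} = ⊤) :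
    Function.Surjective fun p : Fin 6 × Fin 4 ↦ octahedralCosetRep r s p.1 * t ^ (p.2 : ℕ) := by
  intro g
  obtain ⟨i, k, rfl⟩ := exists_eq_octahedralCosetRep_mul hrst hr hs ht hgen g
  refine ⟨(i, ⟨(k % 4).toNat, by omega⟩), ?_⟩
  have hk : ((k % 4).toNat : ℤ) = k % 4 := Int.toNat_of_nonneg (by omega)
  change _ * t ^ (k % 4).toNat = _
  rw [← zpow_natCast, hk]
  exact congrArg _ (zpow_eq_zpow_emod' k ht).symm

end

lemma closure_of_zero_of_one_triangleRels234 :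
    Subgroup.closure {(PresentedGroup.of 0 : PresentedGroup triangleRels234),
      PresentedGroup.of 1} = ⊤ := by
  rw [eq_top_iff, ← PresentedGroup.closure_range_of, Subgroup.closure_le]
  have h0 := Subgroup.subset_closure (k := {(PresentedGroup.of 0 : PresentedGroup triangleRels234),
    PresentedGroup.of 1}) (Set.mem_insert _ _)
  have h1 := Subgroup.subset_closure (k := {(PresentedGroup.of 0 : PresentedGroup triangleRels234),
    PresentedGroup.of 1}) (Set.mem_insert_of_mem _ rfl)
  rintro _ ⟨i, rfl⟩
  fin_cases i
  · exact h0
  · exact h1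
  · have hrst : (PresentedGroup.of 0 : PresentedGroup triangleRels234) * PresentedGroup.of 1 *
        PresentedGroup.of 2 = 1 := PresentedGroup.one_of_mem (by simp [triangleRels234])
    have h := inv_mem (mul_mem h0 h1)
    rwa [inv_eq_of_mul_eq_one_right hrst] at h

/-- Images of `R`, `S`, `T` in `S₄`: a transposition, a `3`-cycle and a `4`-cycle. -/
def trianglePerm234 : Fin 3 → Equiv.Perm (Fin 4) :=
  ![Equiv.swap 0 1, Equiv.swap 0 1 * (finRotate 4)⁻¹, finRotate 4]

lemma lift_trianglePerm234_eq_one :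
    ∀ w ∈ triangleRels234, FreeGroup.lift trianglePerm234 w = 1 := by
  rintro _ (rfl | rfl | rfl | rfl) <;> simp only [map_mul, map_pow, FreeGroup.lift_apply_of] <;>
    decide

lemma toGroup_trianglePerm234_surjective :
    Function.Surjective (PresentedGroup.toGroup lift_trianglePerm234_eq_one) := by
  rw [← MonoidHom.range_eq_top, eq_top_iff,
    ← Equiv.Perm.closure_cycle_adjacent_swap (isCycle_finRotate (n := 2)) support_finRotate 0,
    Subgroup.closure_le]
  rintro _ (rfl | rfl)
  · exact ⟨PresentedGroup.of 2, PresentedGroup.toGroup.of _⟩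
  · exact ⟨PresentedGroup.of 0, PresentedGroup.toGroup.of _⟩

/-- The `(2,3,4)` triangle group `⟨R,S,T ∣ RST = R² = S³ = T⁴ = 1⟩` is isomorphic to the
symmetric group `S₄`, and in particular has order `24`. -/
theorem triangle_2_3_4_iso_symmetric :
    Nonempty (PresentedGroup triangleRels234 ≃* Equiv.Perm (Fin 4)) ∧
    Nat.card (PresentedGroup triangleRels234) = 24 := by
  have hcover := surjective_octahedralCosetRep_mul_pow (t := PresentedGroup.of 2)
    (PresentedGroup.one_of_mem (by simp [triangleRels234]))
    (PresentedGroup.one_of_mem (by simp [triangleRels234]))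
    (PresentedGroup.one_of_mem (by simp [triangleRels234]))
    (PresentedGroup.one_of_mem (by simp [triangleRels234]))
    closure_of_zero_of_one_triangleRels234
  have : Finite (PresentedGroup triangleRels234) := Finite.of_surjective _ hcover
  have hperm : Nat.card (Equiv.Perm (Fin 4)) = 24 := by
    rw [Nat.card_perm, Nat.card_fin]
    rfl
  have hcard : Nat.card (PresentedGroup triangleRels234) ≤ 24 := by
    simpa using Nat.card_le_card_of_surjective _ hcover
  have e := MulEquiv.ofBijective _
    (toGroup_trianglePerm234_surjective.bijective_of_nat_card_le (hcard.trans_eq hperm.symm))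
  exact ⟨⟨e⟩, (Nat.card_congr e.toEquiv).trans hperm⟩
end

section
/- The (2,3,5) triangle group is the alternating group A₅: the group presented by three generators R, S, T subject to the relations R·S·T = 1, R² = 1, S³ = 1, T⁵ = 1 is isomorphic to the alternating group on 5 letters, and in particular has order 60. -/
/-- The relators `RST`, `R²`, `S³`, `T⁵` of the `(2,3,5)` triangle group, where
`R`, `S`, `T` are the three generators of the free group on `Fin 3`. -/
def triangleRels235 : Set (FreeGroup (Fin 3)) :=
  { FreeGroup.of 0 * FreeGroup.of 1 * FreeGroup.of 2,
    FreeGroup.of 0 ^ 2, FreeGroup.of 1 ^ 3, FreeGroup.of 2 ^ 5 }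

section NormalForm

variable {G : Type*} [Group G] {r t : G}

/-- Candidate normal forms of elements of a `(2,3,5)` group generated by `r` and `t`. -/
def icosahedralWord (r t : G) :
    Fin 5 ⊕ (Fin 5 × Fin 5) ⊕ (Fin 5 × Fin 5) ⊕ Fin 5 → G
  | .inl a => t ^ (a : ℕ)
  | .inr (.inl (a, b)) => t ^ (a : ℕ) * r * t ^ (b : ℕ)
  | .inr (.inr (.inl (a, b))) => t ^ (a : ℕ) * (r * t ^ 2 * r) * t ^ (b : ℕ)
  | .inr (.inr (.inr b)) => r * t ^ 2 * r * t ^ (-2 : ℤ) * r * t ^ (b : ℕ)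

lemma exists_fin_pow_eq_zpow (ht : t ^ 5 = 1) (a : ℤ) : ∃ k : Fin 5, t ^ (k : ℕ) = t ^ a := by
  refine ⟨⟨(a % 5).toNat, by omega⟩, ?_⟩
  rw [← zpow_natCast, Int.toNat_of_nonneg (by omega), ← Int.emod_add_mul_ediv a 5]
  simp [zpow_add, zpow_mul, show t ^ (5 : ℤ) = 1 from mod_cast ht]

lemma zpow_eq_of_pow_five (ht : t ^ 5 = 1) (a : ℤ) :
    t ^ a = 1 ∨ t ^ a = t ∨ t ^ a = t⁻¹ ∨ t ^ a = t ^ 2 ∨ t ^ a = t ^ (-2 : ℤ) := by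
  obtain ⟨k, hk⟩ := exists_fin_pow_eq_zpow ht a
  rw [← hk]
  have h3 : t ^ 3 = t ^ (-2 : ℤ) := by
    rw [zpow_neg, eq_inv_iff_mul_eq_one, ← ht]; norm_cast; rw [← pow_add]
  have h4 : t ^ 4 = t⁻¹ := by rw [eq_inv_iff_mul_eq_one, ← ht, ← pow_succ]
  fin_cases k <;> simp [h3, h4]

lemma zpow_mem_range_icosahedralWord (ht : t ^ 5 = 1) (a : ℤ) :
    t ^ a ∈ Set.range (icosahedralWord r t) := by
  obtain ⟨k, hk⟩ := exists_fin_pow_eq_zpow ht a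
  exact ⟨.inl k, hk⟩

lemma zpow_mul_mul_zpow_mem_range_icosahedralWord (ht : t ^ 5 = 1) (a b : ℤ) :
    t ^ a * r * t ^ b ∈ Set.range (icosahedralWord r t) := by
  obtain ⟨k, hk⟩ := exists_fin_pow_eq_zpow ht a
  obtain ⟨l, hl⟩ := exists_fin_pow_eq_zpow ht b
  exact ⟨.inr (.inl (k, l)), by simp [icosahedralWord, hk, hl]⟩

lemma zpow_mul_conj_mul_zpow_mem_range_icosahedralWord (ht : t ^ 5 = 1) (a b : ℤ) :
    t ^ a * (r * t ^ 2 * r) * t ^ b ∈ Set.range (icosahedralWord r t) := by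
  obtain ⟨k, hk⟩ := exists_fin_pow_eq_zpow ht a
  obtain ⟨l, hl⟩ := exists_fin_pow_eq_zpow ht b
  exact ⟨.inr (.inr (.inl (k, l))), by simp only [icosahedralWord, hk, hl]⟩

lemma antipode_mul_zpow_mem_range_icosahedralWord (ht : t ^ 5 = 1) (b : ℤ) :
    r * t ^ 2 * r * t ^ (-2 : ℤ) * r * t ^ b ∈ Set.range (icosahedralWord r t) := by
  obtain ⟨l, hl⟩ := exists_fin_pow_eq_zpow ht b
  exact ⟨.inr (.inr (.inr l)), by simp only [icosahedralWord, hl]⟩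

lemma conj_eq_of_two_three (hr : r * r = 1) (hrt : (t * r) ^ 3 = 1) :
    r * t * r = t⁻¹ * r * t⁻¹ := by
  have hr' : r⁻¹ = r := inv_eq_of_mul_eq_one_left hr
  have h : t * (r * t * r) * (t * r) = 1 := by
    rw [← hrt]
    simp only [pow_succ, pow_zero, one_mul, mul_assoc]
  have h' : r * t * r = t⁻¹ * (t * r)⁻¹ := by
    rw [eq_inv_mul_iff_mul_eq, ← mul_eq_one_iff_eq_inv, h]
  rw [h', mul_inv_rev, hr', mul_assoc]

lemma conj_inv_eq_of_two_three (hr : r * r = 1) (hrt : (t * r) ^ 3 = 1) :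
    r * t⁻¹ * r = t * r * t := by
  have hr' : r⁻¹ = r := inv_eq_of_mul_eq_one_left hr
  have h := congrArg (·⁻¹) (conj_eq_of_two_three hr hrt)
  simpa [hr', mul_assoc] using h

lemma conj_inv_sq_eq_of_two_three (hr : r * r = 1) (hrt : (t * r) ^ 3 = 1) :
    r * t ^ (-2 : ℤ) * r = t * (r * t ^ 2 * r) * t := by
  have h := conj_inv_eq_of_two_three hr hrt
  calc r * t ^ (-2 : ℤ) * r = (r * t⁻¹ * r) * r⁻¹ * r⁻¹ * (r * t⁻¹ * r) := by group
    _ = t * (r * t ^ 2 * r) * t := by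
      rw [inv_eq_of_mul_eq_one_left hr, mul_assoc (r * t⁻¹ * r), hr, h]; simp [sq, mul_assoc]

lemma conj_sq_eq_of_two_three (hr : r * r = 1) (hrt : (t * r) ^ 3 = 1) :
    r * t ^ 2 * r = t⁻¹ * (r * t ^ (-2 : ℤ) * r) * t⁻¹ := by
  rw [conj_inv_sq_eq_of_two_three hr hrt]; group

lemma mul_antipode_eq (hr : r * r = 1) (ht : t ^ 5 = 1) (hrt : (t * r) ^ 3 = 1) :
    r * t ^ (-2 : ℤ) * (r * t ^ 2 * r) =
      r * t ^ 2 * r * t ^ (-2 : ℤ) * r * t⁻¹ := by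
  have h3 : t ^ (-2 : ℤ) * t⁻¹ = t ^ 2 := by
    rw [← mul_one (t ^ (-2 : ℤ) * t⁻¹), ← ht]; group
  rw [conj_sq_eq_of_two_three hr hrt]
  calc r * t ^ (-2 : ℤ) * (t⁻¹ * (r * t ^ (-2 : ℤ) * r) * t⁻¹)
      = r * (t ^ (-2 : ℤ) * t⁻¹) * r * t ^ (-2 : ℤ) * r * t⁻¹ := by group
    _ = _ := by
      rw [h3, ← conj_sq_eq_of_two_three hr hrt]

lemma self_mul_antipode (hr : r * r = 1) (ht : t ^ 5 = 1) (hrt : (t * r) ^ 3 = 1) :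
    t * (r * t ^ 2 * r * t ^ (-2 : ℤ) * r) = r * t ^ 2 * r * t ^ (-2 : ℤ) * r * t⁻¹ := by
  have h3 : t * t ^ 2 = t ^ (-2 : ℤ) := by
    rw [← mul_one (t ^ (-2 : ℤ)), ← ht]; group
  rw [← mul_antipode_eq hr ht hrt]
  calc t * (r * t ^ 2 * r * t ^ (-2 : ℤ) * r)
      = t * (r * t ^ 2 * r) * t * t ^ 2 * r := by rw [← h3]; group
    _ = _ := by rw [← conj_inv_sq_eq_of_two_three hr hrt]; group

lemma zpow_mul_antipode (hr : r * r = 1) (ht : t ^ 5 = 1) (hrt : (t * r) ^ 3 = 1) (a : ℤ) :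
    t ^ a * (r * t ^ 2 * r * t ^ (-2 : ℤ) * r) =
      r * t ^ 2 * r * t ^ (-2 : ℤ) * r * t ^ (-a) := by
  have h : SemiconjBy (r * t ^ 2 * r * t ^ (-2 : ℤ) * r) t⁻¹ t :=
    (self_mul_antipode hr ht hrt).symm
  rw [zpow_neg t a, ← inv_zpow]
  exact (h.zpow_right a).symm

lemma zpow_mul_mem_range_icosahedralWord (hr : r * r = 1) (ht : t ^ 5 = 1)
    (hrt : (t * r) ^ 3 = 1) (c : ℤ) {g : G} (hg : g ∈ Set.range (icosahedralWord r t)) :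
    t ^ c * g ∈ Set.range (icosahedralWord r t) := by
  obtain ⟨a | ⟨a, b⟩ | ⟨a, b⟩ | b, rfl⟩ := hg
  · convert zpow_mem_range_icosahedralWord (r := r) ht (c + a) using 1
    simp [icosahedralWord, zpow_add]
  · convert zpow_mul_mul_zpow_mem_range_icosahedralWord (r := r) ht (c + a) b using 1
    simp [icosahedralWord, zpow_add, mul_assoc]
  · convert zpow_mul_conj_mul_zpow_mem_range_icosahedralWord (r := r) ht (c + a) b using 1
    simp [icosahedralWord, zpow_add, mul_assoc]
  · convert antipode_mul_zpow_mem_range_icosahedralWord (r := r) ht (-c + b) using 1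
    rw [icosahedralWord, ← mul_assoc (t ^ c), zpow_mul_antipode hr ht hrt, zpow_add, zpow_natCast]
    simp only [mul_assoc]

lemma mul_mem_range_icosahedralWord (hr : r * r = 1) (ht : t ^ 5 = 1)
    (hrt : (t * r) ^ 3 = 1) {g : G} (hg : g ∈ Set.range (icosahedralWord r t)) :
    r * g ∈ Set.range (icosahedralWord r t) := by
  have h1 := conj_eq_of_two_three hr hrt
  have h2 := conj_inv_eq_of_two_three hr hrt
  have h3 := conj_inv_sq_eq_of_two_three hr hrt
  have h4 := conj_sq_eq_of_two_three hr hrt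
  have hrr (x : G) : r * (r * x) = x := by rw [← mul_assoc, hr, one_mul]
  have m0 := zpow_mem_range_icosahedralWord (r := r) ht
  have m1 := zpow_mul_mul_zpow_mem_range_icosahedralWord (r := r) ht
  have m2 := zpow_mul_conj_mul_zpow_mem_range_icosahedralWord (r := r) ht
  have m3 := antipode_mul_zpow_mem_range_icosahedralWord (r := r) ht
  obtain ⟨a | ⟨a, b⟩ | ⟨a, b⟩ | b, rfl⟩ := hg
  · convert m1 0 a using 1
    simp [icosahedralWord]
  · rw [icosahedralWord, ← zpow_natCast t a, ← zpow_natCast t b]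
    obtain h | h | h | h | h := zpow_eq_of_pow_five ht a <;> rw [h]
    · simpa [hrr] using m0 b
    · convert m1 (-1) (-1 + b) using 1
      rw [← mul_assoc, ← mul_assoc, h1]; group
    · convert m1 1 (1 + b) using 1
      rw [← mul_assoc, ← mul_assoc, h2]; group
    · convert m2 0 b using 1
      group
    · convert m2 1 (1 + b) using 1
      rw [← mul_assoc, ← mul_assoc, h3]; group
  · rw [icosahedralWord, ← zpow_natCast t a, ← zpow_natCast t b]
    obtain h | h | h | h | h := zpow_eq_of_pow_five ht a <;> rw [h]
    · convert m1 2 b using 1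
      simp only [one_mul, mul_assoc, hrr]; norm_cast
    · convert m1 (-2) (-1 + b) using 1
      calc r * (t * (r * t ^ 2 * r) * t ^ (b : ℤ))
          = (r * t * r) * t ^ 2 * r * t ^ (b : ℤ) := by group
        _ = t⁻¹ * (r * t * r) * t ^ (b : ℤ) := by
          conv_lhs => rw [h1]
          simp [sq, mul_assoc]
        _ = t ^ (-2 : ℤ) * r * t ^ (-1 + b : ℤ) := by rw [h1]; group
    · convert m2 2 (1 + b) using 1
      calc r * (t⁻¹ * (r * t ^ 2 * r) * t ^ (b : ℤ))
          = (r * t⁻¹ * r) * t ^ 2 * r * t ^ (b : ℤ) := by group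
        _ = t * (r * t ^ (3 : ℤ) * r) * t ^ (b : ℤ) := by rw [h2]; group
        _ = t * (r * t ^ (-2 : ℤ) * r) * t ^ (b : ℤ) := by
          rw [show t ^ (3 : ℤ) = t ^ (-2 : ℤ) by rw [← mul_one (t ^ (-2 : ℤ)), ← ht]; group]
        _ = t * t * (r * t ^ 2 * r) * t ^ (1 + b : ℤ) := by rw [h3]; group
        _ = _ := by rw [← sq]; norm_cast
    · convert m2 (-1) (-1 + b) using 1
      calc r * (t ^ 2 * (r * t ^ 2 * r) * t ^ (b : ℤ))
          = r * t * (r * t ^ (-2 : ℤ) * r) * t⁻¹ * t ^ (b : ℤ) := by rw [h4]; group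
        _ = (r * t * r) * t ^ (-2 : ℤ) * r * t⁻¹ * t ^ (b : ℤ) := by group
        _ = t⁻¹ * (r * t ^ (-3 : ℤ) * r) * t⁻¹ * t ^ (b : ℤ) := by rw [h1]; group
        _ = t⁻¹ * (r * t ^ 2 * r) * t⁻¹ * t ^ (b : ℤ) := by
          rw [show t ^ (-3 : ℤ) = t ^ 2 by rw [← mul_one (t ^ (-3 : ℤ)), ← ht]; group]
        _ = _ := by group
    · convert m3 (-1 + b) using 1
      rw [← mul_assoc, ← mul_assoc, mul_antipode_eq hr ht hrt, zpow_add, zpow_neg_one]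
      simp only [mul_assoc]
  · rw [icosahedralWord, ← zpow_natCast t b]
    convert m2 3 (1 + b) using 1
    calc r * (r * t ^ 2 * r * t ^ (-2 : ℤ) * r * t ^ (b : ℤ))
        = t ^ 2 * (r * t ^ (-2 : ℤ) * r) * t ^ (b : ℤ) := by simp only [mul_assoc, hrr]
      _ = _ := by rw [h3]; group

lemma icosahedralWord_surjective (hr : r * r = 1) (ht : t ^ 5 = 1) (hrt : (t * r) ^ 3 = 1)
    (hgen : Subgroup.closure {r, t} = ⊤) : Function.Surjective (icosahedralWord r t) := by
  intro g
  have hg : g ∈ Subgroup.closure {r, t} := hgen ▸ Subgroup.mem_top g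
  induction hg using Subgroup.closure_induction_left with
  | one => exact ⟨.inl 0, by simp [icosahedralWord]⟩
  | mul_left x hx y _ ih =>
    obtain rfl | rfl := hx
    · exact mul_mem_range_icosahedralWord hr ht hrt ih
    · simpa using zpow_mul_mem_range_icosahedralWord hr ht hrt 1 ih
  | inv_mul_cancel x hx y _ ih =>
    obtain rfl | rfl := hx
    · rw [inv_eq_of_mul_eq_one_left hr]
      exact mul_mem_range_icosahedralWord hr ht hrt ih
    · simpa using zpow_mul_mem_range_icosahedralWord hr ht hrt (-1) ih

end NormalForm

/-- The images of `R`, `S`, `T` in the alternating group on five letters. -/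
def triangleGen235 : Fin 3 → alternatingGroup (Fin 5) :=
  ![⟨Equiv.swap 0 1 * Equiv.swap 2 3, by rw [Equiv.Perm.mem_alternatingGroup]; decide⟩,
    ⟨Equiv.swap 0 2 * Equiv.swap 0 4, by rw [Equiv.Perm.mem_alternatingGroup]; decide⟩,
    ⟨finRotate 5, by rw [Equiv.Perm.mem_alternatingGroup]; decide⟩]

lemma lift_triangleGen235_eq_one :
    ∀ w ∈ triangleRels235, FreeGroup.lift triangleGen235 w = 1 := by
  rintro _ (rfl | rfl | rfl | rfl) <;> simp <;> decide

lemma nat_card_alternatingGroup_fin_five : Nat.card (alternatingGroup (Fin 5)) = 60 := by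
  rw [nat_card_alternatingGroup]; simp [Nat.factorial]

lemma closure_range_triangleGen235 : Subgroup.closure (Set.range triangleGen235) = ⊤ := by
  set H := Subgroup.closure (Set.range triangleGen235)
  have hmem (i : Fin 3) : triangleGen235 i ∈ H := Subgroup.subset_closure ⟨i, rfl⟩
  have hdvd (i : Fin 3) (n : ℕ) [Fact n.Prime] (h : triangleGen235 i ^ n = 1)
      (h1 : triangleGen235 i ≠ 1) : n ∣ Nat.card H := by
    rw [← orderOf_eq_prime h h1]; exact H.orderOf_dvd_natCard (hmem i)
  have : Fact (Nat.Prime 5) := ⟨by norm_num⟩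
  have h2 : 2 ∣ Nat.card H := hdvd 0 2 (by decide) (by decide)
  have h3 : 3 ∣ Nat.card H := hdvd 1 3 (by decide) (by decide)
  have h5 : 5 ∣ Nat.card H := hdvd 2 5 (by decide) (by decide)
  have hmul := H.card_mul_index
  rw [nat_card_alternatingGroup_fin_five] at hmul
  obtain ⟨k, hk⟩ : 30 ∣ Nat.card H := by omega
  have hindex : k * H.index = 2 := by rw [hk] at hmul; lia
  have hdvd2 : H.index ∣ 2 := ⟨k, by lia⟩
  obtain h | h := (Nat.dvd_prime Nat.prime_two).1 hdvd2
  · exact Subgroup.index_eq_one.1 h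
  · have := alternatingGroup.isSimpleGroup (α := Fin 5) (by simp)
    refine (Subgroup.normal_of_index_eq_two h).eq_bot_or_eq_top.resolve_left fun hbot => ?_
    simp [hbot] at hk
    omega

lemma closure_pair_triangle235 :
    Subgroup.closure {PresentedGroup.of (rels := triangleRels235) 0, .of 2} = ⊤ := by
  have hrel := PresentedGroup.one_of_mem (rels := triangleRels235)
    (x := .of 0 * .of 1 * .of 2) (by simp [triangleRels235])
  rw [map_mul, map_mul] at hrel
  rw [eq_top_iff, ← PresentedGroup.closure_range_of, Subgroup.closure_le]
  have h0 : PresentedGroup.of (rels := triangleRels235) 0 ∈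
      Subgroup.closure {PresentedGroup.of (rels := triangleRels235) 0, .of 2} :=
    Subgroup.subset_closure (by simp)
  have h2 : PresentedGroup.of (rels := triangleRels235) 2 ∈
      Subgroup.closure {PresentedGroup.of (rels := triangleRels235) 0, .of 2} :=
    Subgroup.subset_closure (by simp)
  rintro _ ⟨i, rfl⟩
  match i with
  | 0 => exact h0
  | 1 =>
    rw [mul_assoc, mul_eq_one_iff_inv_eq, eq_comm, ← eq_mul_inv_iff_mul_eq] at hrel
    exact hrel.symm.subst (motive := (· ∈ Subgroup.closure _)) (mul_mem (inv_mem h0) (inv_mem h2))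
  | 2 => exact h2

lemma icosahedralWord_triangle235_surjective :
    Function.Surjective
      (icosahedralWord (PresentedGroup.of (rels := triangleRels235) 0) (.of 2)) := by
  have h0 := PresentedGroup.one_of_mem (rels := triangleRels235)
    (x := .of 0 * .of 1 * .of 2) (by simp [triangleRels235])
  have hR := PresentedGroup.one_of_mem (rels := triangleRels235)
    (x := .of 0 ^ 2) (by simp [triangleRels235])
  have hS := PresentedGroup.one_of_mem (rels := triangleRels235)
    (x := .of 1 ^ 3) (by simp [triangleRels235])
  have hT := PresentedGroup.one_of_mem (rels := triangleRels235)
    (x := .of 2 ^ 5) (by simp [triangleRels235])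
  rw [map_mul, map_mul, mul_assoc, mul_eq_one_iff_inv_eq, eq_comm, ← eq_mul_inv_iff_mul_eq,
    ← mul_inv_rev] at h0
  rw [map_pow] at hR hS hT
  rw [h0, inv_pow, inv_eq_one] at hS
  exact icosahedralWord_surjective (by rw [← sq]; exact hR) hT hS closure_pair_triangle235

/-- The `(2,3,5)` triangle group `⟨R,S,T ∣ RST = R² = S³ = T⁵ = 1⟩` is isomorphic to the
alternating group `A₅`, and in particular has order `60`. -/
theorem triangle_2_3_5_iso_alternating :
    Nonempty (PresentedGroup triangleRels235 ≃* alternatingGroup (Fin 5)) ∧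
    Nat.card (PresentedGroup triangleRels235) = 60 := by
  have hword := icosahedralWord_triangle235_surjective
  have : Finite (PresentedGroup triangleRels235) := Finite.of_surjective _ hword
  have hle : Nat.card (PresentedGroup triangleRels235) ≤ 60 := by
    simpa using Nat.card_le_card_of_surjective _ hword
  let φ := PresentedGroup.toGroup lift_triangleGen235_eq_one
  have hφ : Function.Surjective φ := by
    rw [← MonoidHom.range_eq_top, eq_top_iff, ← closure_range_triangleGen235, Subgroup.closure_le]
    rintro _ ⟨i, rfl⟩
    exact ⟨.of i, PresentedGroup.toGroup.of _⟩
  have hbij : Function.Bijective φ := hφ.bijective_of_nat_card_le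
    (hle.trans nat_card_alternatingGroup_fin_five.ge)
  let e := MulEquiv.ofBijective φ hbij
  exact ⟨⟨e⟩, (Nat.card_congr e.toEquiv).trans nat_card_alternatingGroup_fin_five⟩
end

section
/- The binary tetrahedral group has order 24: the group presented by three generators r, s, t subject to the relations r² = s³ = t³ = r·s·t (i.e., with relators r²(rst)⁻¹, s³(rst)⁻¹, t³(rst)⁻¹) is a finite group of order 24. -/
/-- The relators `r²(rst)⁻¹`, `s³(rst)⁻¹`, `t³(rst)⁻¹` of the binary tetrahedral group,
where `r`, `s`, `t` are the three generators of the free group on `Fin 3`.  The group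
presented by these relators satisfies `r² = s³ = t³ = rst`, and the common value is not
required to be the identity. -/
def binaryTetrahedralRels : Set (FreeGroup (Fin 3)) :=
  { FreeGroup.of 0 ^ 2 * (FreeGroup.of 0 * FreeGroup.of 1 * FreeGroup.of 2)⁻¹,
    FreeGroup.of 1 ^ 3 * (FreeGroup.of 0 * FreeGroup.of 1 * FreeGroup.of 2)⁻¹,
    FreeGroup.of 2 ^ 3 * (FreeGroup.of 0 * FreeGroup.of 1 * FreeGroup.of 2)⁻¹ }

section Relations

variable {G : Type*} [Group G] {s t : G}

theorem commute_cube_of_tetrahedral_relations (hs : t * s * t = s ^ 2) (ht : s * t * s = t ^ 2) :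
    Commute (s ^ 3) t := by
  have h : s ^ 3 = t ^ 3 := by
    calc s ^ 3 = s * (t * s * t) := by rw [hs]; simp only [pow_succ, pow_zero, one_mul, mul_assoc]
      _ = s * t * s * t := by simp only [mul_assoc]
      _ = t ^ 3 := by rw [ht]; simp only [pow_succ, pow_zero, one_mul, mul_assoc]
  rw [h]
  exact (Commute.refl t).pow_left 3

theorem mul_sq_mul_of_tetrahedral_relations (hs : t * s * t = s ^ 2) (ht : s * t * s = t ^ 2) :
    t * s ^ 2 * t = s ^ 2 * t * s ^ 5 := by
  have hc := (commute_cube_of_tetrahedral_relations hs ht).eq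
  calc t * s ^ 2 * t = t ^ 2 * s * t ^ 2 := by
          rw [← hs]
          simp only [pow_succ, pow_zero, one_mul, mul_assoc]
    _ = s * (t * s ^ 3) * t * s := by rw [← ht]; simp only [pow_succ, pow_zero, one_mul, mul_assoc]
    _ = s ^ 4 * t ^ 2 * s := by rw [← hc]; simp only [pow_succ, pow_zero, one_mul, mul_assoc]
    _ = s ^ 2 * (s ^ 3 * t) * s ^ 2 := by
        rw [← ht]
        simp only [pow_succ, pow_zero, one_mul, mul_assoc]
    _ = s ^ 2 * t * s ^ 5 := by rw [hc]; simp only [pow_succ, pow_zero, one_mul, mul_assoc]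

theorem pow_six_eq_one_of_tetrahedral_relations (hs : t * s * t = s ^ 2) (ht : s * t * s = t ^ 2) :
    s ^ 6 = 1 := by
  have hc := (commute_cube_of_tetrahedral_relations hs ht).eq
  -- Evaluate `(s * t ^ 2 * s) * (t * s ^ 2 * t)` in two ways.
  have h₁ : s * t ^ 2 * s * (t * s ^ 2 * t) = s ^ 6 := by
    calc s * t ^ 2 * s * (t * s ^ 2 * t) = s * t * (t * s * t) * s ^ 2 * t := by
            simp only [pow_succ, pow_zero, one_mul, mul_assoc]
      _ = s * (t * s ^ 3) * s * t := by rw [hs]; simp only [pow_succ, pow_zero, one_mul, mul_assoc]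
      _ = s ^ 3 * (s * (t * s * t)) := by
          rw [← hc]
          simp only [pow_succ, pow_zero, one_mul, mul_assoc]
      _ = s ^ 6 := by rw [hs]; simp only [pow_succ, pow_zero, one_mul, mul_assoc]
  have h₂ : s * t ^ 2 * s * (t * s ^ 2 * t) = s ^ 12 := by
    calc s * t ^ 2 * s * (t * s ^ 2 * t)
        = s ^ 2 * (t * s ^ 3) * s * t * s ^ 5 := by
          rw [mul_sq_mul_of_tetrahedral_relations hs ht, ← ht]
          simp only [pow_succ, pow_zero, one_mul, mul_assoc]
      _ = s ^ 5 * (t * s * t) * s ^ 5 := by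
          rw [← hc]
          simp only [pow_succ, pow_zero, one_mul, mul_assoc]
      _ = s ^ 12 := by rw [hs]; simp only [pow_succ, pow_zero, one_mul, mul_assoc]
  have h : s ^ 6 * s ^ 6 = s ^ 6 * 1 := by rw [← pow_add, mul_one, ← h₁, h₂]
  exact mul_left_cancel h

end Relations

open scoped Pointwise in
theorem MulAction.eq_univ_of_smul_subset {G X : Type*} [Group G] [MulAction G X]
    [MulAction.IsPretransitive G X] {A : Set G} (hA : Subgroup.closure A = ⊤) {S : Set X}
    (hfin : S.Finite) (hne : S.Nonempty) (hS : ∀ g ∈ A, ∀ x ∈ S, g • x ∈ S) :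
    S = Set.univ := by
  classical
  have hstab : MulAction.stabilizer G hfin.toFinset = ⊤ := by
    rw [eq_top_iff, ← hA, Subgroup.closure_le]
    intro g hg
    refine Finset.eq_of_subset_of_card_le (fun y hy => ?_) (by simp)
    obtain ⟨x, hx, rfl⟩ := Finset.mem_smul_finset.mp hy
    simpa using hS g hg x (by simpa using hx)
  obtain ⟨x, hx⟩ := hne
  refine Set.eq_univ_of_forall fun y => ?_
  obtain ⟨g, rfl⟩ := MulAction.exists_smul_eq G x y
  have hg : g • hfin.toFinset = hfin.toFinset :=
    MulAction.mem_stabilizer_iff.mp (hstab ▸ Subgroup.mem_top g)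
  have h : g • x ∈ g • hfin.toFinset := Finset.smul_mem_smul_finset (by simpa using hx)
  rw [hg] at h
  simpa using h

/-- The words `u sᵏ`, where `u` runs over the coset representatives `1, t, st, s²t` of `⟨s⟩`. -/
def cosetWord {G : Type*} [Group G] (s t : G) (p : Fin 4 × Fin 6) : G :=
  ![1, t, s * t, s ^ 2 * t] p.1 * s ^ (p.2 : ℕ)

theorem map_cosetWord {G H : Type*} [Group G] [Group H] (f : G →* H) (s t : G)
    (p : Fin 4 × Fin 6) : f (cosetWord s t p) = cosetWord (f s) (f t) p := by
  obtain ⟨i, k⟩ := p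
  fin_cases i <;> simp [cosetWord]

theorem cosetWord_surjective {G : Type*} [Group G] {s t : G} (hs : t * s * t = s ^ 2)
    (ht : s * t * s = t ^ 2) (hgen : Subgroup.closure {s, t} = ⊤) :
    Function.Surjective (cosetWord s t) := by
  let u : Fin 4 → G := ![1, t, s * t, s ^ 2 * t]
  have key (g : G) (n : ℕ) (i j : Fin 4) (h : g * u i = u j * s ^ n) :
      g • (u i : G ⧸ Subgroup.zpowers s) = (u j : G ⧸ Subgroup.zpowers s) := by
    rw [MulAction.Quotient.smul_coe, smul_eq_mul, h]
    exact QuotientGroup.mk_mul_of_mem _ (Subgroup.npow_mem_zpowers s n)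
  have hc := (commute_cube_of_tetrahedral_relations hs ht).eq
  have huniv : Set.range (fun i => (u i : G ⧸ Subgroup.zpowers s)) = Set.univ := by
    refine MulAction.eq_univ_of_smul_subset hgen (Set.finite_range _) (Set.range_nonempty _) ?_
    rintro g (rfl | rfl) _ ⟨i, rfl⟩
    · fin_cases i
      · exact ⟨0, (key g 1 0 0 (by simp [u])).symm⟩
      · exact ⟨2, (key g 0 1 2 (by simp [u])).symm⟩
      · exact ⟨3, (key g 0 2 3 (by simp [u, pow_two, mul_assoc])).symm⟩
      · refine ⟨1, (key g 3 3 1 ?_).symm⟩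
        change g * (g ^ 2 * t) = t * g ^ 3
        rw [← hc]; group
    · fin_cases i
      · exact ⟨1, (key g 0 0 1 (by simp [u])).symm⟩
      · refine ⟨2, (key g 1 1 2 ?_).symm⟩
        change g * g = s * g * s ^ 1
        rw [pow_one, ht, pow_two]
      · refine ⟨0, (key g 2 2 0 ?_).symm⟩
        change g * (s * g) = 1 * s ^ 2
        rw [← mul_assoc, hs, one_mul]
      · refine ⟨3, (key g 5 3 3 ?_).symm⟩
        change g * (s ^ 2 * g) = s ^ 2 * g * s ^ 5
        rw [← mul_assoc, mul_sq_mul_of_tetrahedral_relations hs ht]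
  intro g
  obtain ⟨i, hi⟩ : (g : G ⧸ Subgroup.zpowers s) ∈
      Set.range (fun i => (u i : G ⧸ Subgroup.zpowers s)) := huniv ▸ Set.mem_univ _
  obtain ⟨k, hk⟩ := Subgroup.mem_zpowers_iff.mp (QuotientGroup.eq.mp hi)
  have h6 := pow_six_eq_one_of_tetrahedral_relations hs ht
  have hlt : (k % 6).toNat < 6 := by omega
  refine ⟨(i, ⟨(k % 6).toNat, hlt⟩), ?_⟩
  change u i * s ^ (k % 6).toNat = g
  have hmod : s ^ (k % 6).toNat = s ^ k := by
    rw [← zpow_natCast, Int.toNat_of_nonneg (by omega)]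
    exact (zpow_eq_zpow_emod' k h6).symm
  rw [hmod, hk, mul_inv_cancel_left]

namespace BinaryTetrahedral

open PresentedGroup Matrix

/-- The images of `r`, `s`, `t` in `SL(2, 𝔽₃)`. -/
def generator : Fin 3 → SpecialLinearGroup (Fin 2) (ZMod 3) :=
  ![⟨!![2, 1; 1, 1], by decide⟩, ⟨!![2, 2; 0, 2], by decide⟩, ⟨!![2, 0; 2, 2], by decide⟩]

theorem lift_generator_eq_one :
    ∀ x ∈ binaryTetrahedralRels, FreeGroup.lift generator x = 1 := by
  rintro x (rfl | rfl | rfl) <;>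
  · simp only [map_mul, map_inv, map_pow, FreeGroup.lift_apply_of]
    decide

/-- The representation of the binary tetrahedral group in `SL(2, 𝔽₃)`. -/
def toSL : PresentedGroup binaryTetrahedralRels →* SpecialLinearGroup (Fin 2) (ZMod 3) :=
  PresentedGroup.toGroup lift_generator_eq_one

theorem cosetWord_generator_injective :
    Function.Injective (cosetWord (generator 1) (generator 2)) := by
  decide

theorem cosetWord_injective :
    Function.Injective (cosetWord (of (rels := binaryTetrahedralRels) 1) (of 2)) := by
  refine Function.Injective.of_comp (f := toSL) ?_
  convert cosetWord_generator_injective using 1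
  funext p
  simp [map_cosetWord, toSL]

theorem of_zero_sq :
    of (rels := binaryTetrahedralRels) 0 ^ 2 = of 0 * of 1 * of 2 :=
  mul_inv_eq_one.mp (one_of_mem (rels := binaryTetrahedralRels) (Or.inl rfl))

theorem of_one_cube :
    of (rels := binaryTetrahedralRels) 1 ^ 3 = of 0 * of 1 * of 2 :=
  mul_inv_eq_one.mp (one_of_mem (rels := binaryTetrahedralRels) (Or.inr (Or.inl rfl)))

theorem of_two_cube :
    of (rels := binaryTetrahedralRels) 2 ^ 3 = of 0 * of 1 * of 2 :=
  mul_inv_eq_one.mp (one_of_mem (rels := binaryTetrahedralRels) (Or.inr (Or.inr rfl)))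

theorem of_zero : of (rels := binaryTetrahedralRels) 0 = of 1 * of 2 := by
  have h := of_zero_sq
  rw [pow_two, mul_assoc] at h
  exact mul_left_cancel h

theorem closure_one_two :
    Subgroup.closure {of (rels := binaryTetrahedralRels) 1, of 2} = ⊤ := by
  rw [eq_top_iff, ← closure_range_of, Subgroup.closure_le]
  have h₁ : of 1 ∈ Subgroup.closure {of (rels := binaryTetrahedralRels) 1, of 2} :=
    Subgroup.subset_closure (Or.inl rfl)
  have h₂ : of 2 ∈ Subgroup.closure {of (rels := binaryTetrahedralRels) 1, of 2} :=
    Subgroup.subset_closure (Or.inr rfl)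
  rintro _ ⟨i, rfl⟩
  fin_cases i
  · exact of_zero ▸ mul_mem h₁ h₂
  · exact h₁
  · exact h₂

theorem cosetWord_bijective :
    Function.Bijective (cosetWord (of (rels := binaryTetrahedralRels) 1) (of 2)) := by
  refine ⟨cosetWord_injective, cosetWord_surjective ?_ ?_ closure_one_two⟩
  · apply mul_left_cancel (a := of (rels := binaryTetrahedralRels) 1)
    rw [← pow_succ', of_one_cube, of_zero]
    simp only [mul_assoc]
  · apply mul_right_cancel (b := of (rels := binaryTetrahedralRels) 2)
    rw [← pow_succ, of_two_cube, of_zero]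

end BinaryTetrahedral

/-- The binary tetrahedral group `⟨r,s,t ∣ r² = s³ = t³ = rst⟩` is a finite group of
order `24`. -/
theorem binaryTetrahedral_card :
    Finite (PresentedGroup binaryTetrahedralRels) ∧
    Nat.card (PresentedGroup binaryTetrahedralRels) = 24 := by
  have h := BinaryTetrahedral.cosetWord_bijective
  exact ⟨Finite.of_surjective _ h.surjective, by simp [← Nat.card_eq_of_bijective _ h]⟩
end

section
/- The binary octahedral group has order 48: the group presented by three generators r, s, t subject to the relations r² = s³ = t⁴ = r·s·t (i.e., with relators r²(rst)⁻¹, s³(rst)⁻¹, t⁴(rst)⁻¹) is a finite group of order 48. -/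
/-- The relators `r²(rst)⁻¹`, `s³(rst)⁻¹`, `t⁴(rst)⁻¹` of the binary octahedral group,
where `r`, `s`, `t` are the three generators of the free group on `Fin 3`.  The group
presented by these relators satisfies `r² = s³ = t⁴ = rst`, and the common value is not
required to be the identity. -/
def binaryOctahedralRels : Set (FreeGroup (Fin 3)) :=
  { FreeGroup.of 0 ^ 2 * (FreeGroup.of 0 * FreeGroup.of 1 * FreeGroup.of 2)⁻¹,
    FreeGroup.of 1 ^ 3 * (FreeGroup.of 0 * FreeGroup.of 1 * FreeGroup.of 2)⁻¹,
    FreeGroup.of 2 ^ 4 * (FreeGroup.of 0 * FreeGroup.of 1 * FreeGroup.of 2)⁻¹ }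

namespace BinaryOctahedral

section Relations

variable {G : Type*} [Group G] {s t : G}

/-- Representatives of the left cosets of `⟨t⟩` in the binary octahedral group. -/
def cosetRep (s t : G) : Fin 6 → G :=
  ![1, s, t * s, t ^ 2 * s, t ^ 3 * s, s⁻¹ * t ^ 2 * s]

theorem pow_three_eq_pow_four (h₁ : t * s * t = s ^ 2) (h₂ : s * t * s = t ^ 3) :
    s ^ 3 = t ^ 4 := by
  calc s ^ 3 = s * s ^ 2 := by group
    _ = (s * t * s) * t := by rw [← h₁]; group
    _ = t ^ 4 := by rw [h₂]; group

theorem commute_pow_four (h₁ : t * s * t = s ^ 2) (h₂ : s * t * s = t ^ 3) :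
    Commute (t ^ 4) s := by
  rw [← pow_three_eq_pow_four h₁ h₂]
  exact Commute.pow_self s 3

theorem conj_eq_inv_mul_sq (h₂ : s * t * s = t ^ 3) : t * s * t⁻¹ = s⁻¹ * t ^ 2 := by
  calc t * s * t⁻¹ = s⁻¹ * (s * t * s) * t⁻¹ := by group
    _ = s⁻¹ * t ^ 2 := by rw [h₂]; group

theorem sq_mul_conj_sq (h₁ : t * s * t = s ^ 2) (h₂ : s * t * s = t ^ 3) :
    t ^ 2 * (s * t ^ 2 * s⁻¹) = s⁻¹ * t ^ 2 * s := by
  calc t ^ 2 * (s * t ^ 2 * s⁻¹) = t * (t * s * t) * t * s⁻¹ := by simp only [sq, mul_assoc]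
    _ = (t * s * t⁻¹) * (t * s * t) * s⁻¹ := by
        nth_rewrite 1 [h₁]
        simp [sq, mul_assoc]
    _ = s⁻¹ * t ^ 2 * s := by rw [conj_eq_inv_mul_sq h₂, h₁]; group

theorem conj_sq_mul_sq (h₁ : t * s * t = s ^ 2) (h₂ : s * t * s = t ^ 3) :
    (s⁻¹ * t ^ 2 * s) * t ^ 2 = s * t ^ 2 * s⁻¹ := by
  have hc : t ^ 2 * s ^ 3 = s ^ 3 * t ^ 2 := by
    rw [pow_three_eq_pow_four h₁ h₂]; group
  calc (s⁻¹ * t ^ 2 * s) * t ^ 2 = s⁻¹ * (t ^ 2 * (s * t ^ 2 * s⁻¹)) * s := by group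
    _ = s⁻¹ * s⁻¹ * (t ^ 2 * s ^ 3) * s⁻¹ := by
        rw [sq_mul_conj_sq h₁ h₂]; simp [pow_succ, mul_assoc]
    _ = s * t ^ 2 * s⁻¹ := by rw [hc]; simp [pow_succ, mul_assoc]

theorem pow_eight_eq_one (h₁ : t * s * t = s ^ 2) (h₂ : s * t * s = t ^ 3) : t ^ 8 = 1 := by
  have hk := sq_mul_conj_sq h₁ h₂
  rw [← conj_sq_mul_sq h₁ h₂] at hk
  have hz : (s⁻¹ * t ^ 2 * s) * t ^ 4 = t ^ 4 * (s⁻¹ * t ^ 2 * s) := by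
    have h := commute_pow_four h₁ h₂
    exact ((h.inv_right.mul_right ((Commute.refl t).pow_pow 4 2)).mul_right h).eq.symm
  generalize s⁻¹ * t ^ 2 * s = k at hk hz
  have h : t ^ 4 * k * t ^ 4 = k := by
    calc t ^ 4 * k * t ^ 4 = t ^ 2 * (t ^ 2 * (k * t ^ 2)) * t ^ 2 := by group
      _ = k := by rw [hk, mul_assoc, hk]
  rw [mul_assoc, hz, ← mul_assoc, mul_eq_right, ← pow_add] at h
  exact h

theorem mul_conj_sq (h₁ : t * s * t = s ^ 2) (h₂ : s * t * s = t ^ 3) :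
    t * (s⁻¹ * t ^ 2 * s) = s⁻¹ * t ^ 2 * s * t ^ 7 := by
  have hz := commute_pow_four h₁ h₂
  have h : t * (s * t ^ 2 * s⁻¹) = s⁻¹ * t ^ 2 * s * t := by
    have hs : t ^ 2 * s⁻¹ = t⁻¹ * s * t := by
      calc t ^ 2 * s⁻¹ = t⁻¹ * t⁻¹ * (t ^ 4 * s⁻¹) := by group
        _ = t⁻¹ * t⁻¹ * (s ^ 3 * s⁻¹) := by rw [pow_three_eq_pow_four h₁ h₂]
        _ = t⁻¹ * t⁻¹ * s ^ 2 := by group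
        _ = t⁻¹ * s * t := by rw [← h₁]; group
    rw [← conj_eq_inv_mul_sq h₂, mul_assoc s, hs]
    group
  calc t * (s⁻¹ * t ^ 2 * s) = t ^ 2 * (t * (s * t ^ 2 * s⁻¹)) := by
        rw [← sq_mul_conj_sq h₁ h₂]; group
    _ = t ^ 2 * (s⁻¹ * t ^ 2 * s) * t := by rw [h]; group
    _ = t ^ 4 * (s * t ^ 2 * s⁻¹) * t := by rw [← sq_mul_conj_sq h₁ h₂]; group
    _ = s * t ^ 2 * s⁻¹ * t ^ 4 * t := by
        rw [((hz.mul_right ((Commute.refl t).pow_pow 4 2)).mul_right hz.inv_right).eq]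
    _ = s⁻¹ * t ^ 2 * s * t ^ 7 := by rw [← conj_sq_mul_sq h₁ h₂]; group

theorem s_mul_cosetRep (h₁ : t * s * t = s ^ 2) (h₂ : s * t * s = t ^ 3) (c : Fin 6) :
    s * cosetRep s t c =
      cosetRep s t (![1, 2, 0, 4, 5, 3] c) * t ^ (![0, 1, 3, 7, 5, 0] c : ℕ) := by
  have h₈ := pow_eight_eq_one h₁ h₂
  have hz := (commute_pow_four h₁ h₂).eq
  fin_cases c <;> simp [cosetRep]
  · rw [h₁, sq]
  · rw [← mul_assoc, h₂]
  · calc s * (t ^ 2 * s) = t⁻¹ * (t * s * t) * t * s := by simp [sq, mul_assoc]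
      _ = t⁻¹ * s * (s * t * s) := by rw [h₁]; simp [sq, mul_assoc]
      _ = t⁻¹ * (s * t ^ 4) * t⁻¹ * t ^ 8 := by rw [h₂, h₈]; group
      _ = t ^ 3 * s * t ^ 7 := by rw [← hz]; group
  · calc s * (t ^ 3 * s) = s * (s * t * s) * s := by rw [h₂]; group
      _ = s ^ 2 * t * s ^ 2 := by simp [sq, mul_assoc]
      _ = s ^ 3 * (s⁻¹ * t ^ 2 * s) * t := by nth_rewrite 2 [← h₁]; simp [pow_succ, mul_assoc]
      _ = s⁻¹ * t ^ 2 * s ^ 3 * s * t := by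
        have h : s ^ 3 * t ^ 2 = t ^ 2 * s ^ 3 := by
          rw [pow_three_eq_pow_four h₁ h₂]; group
        rw [mul_assoc _ (t ^ 2) (s ^ 3), ← h]; group
      _ = s⁻¹ * t ^ 2 * (t ^ 4 * s) * t := by rw [pow_three_eq_pow_four h₁ h₂]; group
      _ = s⁻¹ * t ^ 2 * s * t ^ 5 := by rw [hz]; group
  · group

theorem t_mul_cosetRep (h₁ : t * s * t = s ^ 2) (h₂ : s * t * s = t ^ 3) (c : Fin 6) :
    t * cosetRep s t c =
      cosetRep s t (![0, 2, 3, 4, 1, 5] c) * t ^ (![1, 0, 0, 0, 4, 7] c : ℕ) := by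
  fin_cases c <;> simp [cosetRep]
  · simp [sq, mul_assoc]
  · group
  · rw [← (commute_pow_four h₁ h₂).eq]; group
  · exact mul_conj_sq h₁ h₂

/-- The normal form `x * t ^ k`, with `x` a coset representative. -/
def normalForm (s t : G) (p : Fin 6 × Fin 8) : G :=
  cosetRep s t p.1 * t ^ (p.2 : ℕ)

theorem cosetRep_mul_pow_mem_range (h₈ : t ^ 8 = 1) (c : Fin 6) (k : ℕ) :
    cosetRep s t c * t ^ k ∈ Set.range (normalForm s t) :=
  ⟨(c, ⟨k % 8, Nat.mod_lt _ (by norm_num)⟩), by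
    rw [normalForm, pow_eq_pow_mod k h₈]⟩

theorem normalForm_surjective (h₁ : t * s * t = s ^ 2) (h₂ : s * t * s = t ^ 3)
    (hgen : Subgroup.closure {s, t} = ⊤) : Function.Surjective (normalForm s t) := by
  have h₈ := pow_eight_eq_one h₁ h₂
  have hs (g : G) (hg : g ∈ Set.range (normalForm s t)) :
      s * g ∈ Set.range (normalForm s t) := by
    obtain ⟨⟨c, k⟩, rfl⟩ := hg
    rw [normalForm, ← mul_assoc, s_mul_cosetRep h₁ h₂, mul_assoc, ← pow_add]
    exact cosetRep_mul_pow_mem_range h₈ _ _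
  have ht (g : G) (hg : g ∈ Set.range (normalForm s t)) :
      t * g ∈ Set.range (normalForm s t) := by
    obtain ⟨⟨c, k⟩, rfl⟩ := hg
    rw [normalForm, ← mul_assoc, t_mul_cosetRep h₁ h₂, mul_assoc, ← pow_add]
    exact cosetRep_mul_pow_mem_range h₈ _ _
  have hinv (x : G) (hx : ∀ g ∈ Set.range (normalForm s t), x * g ∈ Set.range (normalForm s t))
      (g : G) (hg : g ∈ Set.range (normalForm s t)) :
      x⁻¹ * g ∈ Set.range (normalForm s t) := by
    have himage : (x * ·) '' Set.range (normalForm s t) = Set.range (normalForm s t) :=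
      Set.eq_of_subset_of_ncard_le (Set.image_subset_iff.2 hx)
        (Set.ncard_image_of_injective _ (mul_right_injective x)).ge (Set.finite_range _)
    obtain ⟨y, hy, rfl⟩ := himage.symm ▸ hg
    simpa using hy
  intro g
  have hg : g ∈ Subgroup.closure {s, t} := hgen ▸ Subgroup.mem_top g
  induction hg using Subgroup.closure_induction_left with
  | one => exact ⟨(0, 0), by simp [normalForm, cosetRep]⟩
  | mul_left x hx y hy ih =>
    rcases hx with rfl | rfl
    exacts [hs y ih, ht y ih]
  | inv_mul_cancel x hx y hy ih =>
    rcases hx with rfl | rfl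
    exacts [hinv _ hs y ih, hinv _ ht y ih]

end Relations

/-- A matrix of order eight in `SL₂(𝔽₇)`, acting on the plane `𝔽₇²`. -/
def permT : Equiv.Perm (ZMod 7 × ZMod 7) where
  toFun p := (-p.2, p.1 + 3 * p.2)
  invFun p := (3 * p.1 + p.2, -p.1)
  left_inv := by decide
  right_inv := by decide

/-- A matrix of order six in `SL₂(𝔽₇)`, acting on the plane `𝔽₇²`. -/
def permS : Equiv.Perm (ZMod 7 × ZMod 7) where
  toFun p := (2 * p.1 + 4 * p.2, p.1 - p.2)
  invFun p := (-p.1 - 4 * p.2, -p.1 + 2 * p.2)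
  left_inv := by decide
  right_inv := by decide

theorem perm_relations : ∀ x ∈ binaryOctahedralRels,
    FreeGroup.lift ![permS * permT, permS, permT] x = 1 := by
  have h₁ : (permS * permT) ^ 2 = permS * permT * permS * permT := by simp [sq, mul_assoc]
  have h₂ : permS ^ 3 = permS * permT * permS * permT := by
    ext p : 1; revert p; decide
  have h₃ : permT ^ 4 = permS * permT * permS * permT := by
    ext p : 1; revert p; decide
  intro x hx
  simp only [binaryOctahedralRels, Set.mem_insert_iff, Set.mem_singleton_iff] at hx
  rcases hx with rfl | rfl | rfl <;> simp [h₁, h₂, h₃, mul_assoc]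

theorem injective_perm : Function.Injective fun p : Fin 6 × Fin 8 =>
    normalForm permS permT p (1, 0) := by
  decide

end BinaryOctahedral

open BinaryOctahedral in
/-- The binary octahedral group `⟨r,s,t ∣ r² = s³ = t⁴ = rst⟩` is a finite group of
order `48`. -/
theorem binaryOctahedral_card :
    Finite (PresentedGroup binaryOctahedralRels) ∧
    Nat.card (PresentedGroup binaryOctahedralRels) = 48 := by
  let x (i : Fin 3) : PresentedGroup binaryOctahedralRels := PresentedGroup.of i
  have hr : x 0 ^ 2 = x 0 * x 1 * x 2 :=
    PresentedGroup.mk_eq_mk_of_mul_inv_mem (by simp [binaryOctahedralRels])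
  have hs : x 1 ^ 3 = x 0 * x 1 * x 2 :=
    PresentedGroup.mk_eq_mk_of_mul_inv_mem (by simp [binaryOctahedralRels])
  have ht : x 2 ^ 4 = x 0 * x 1 * x 2 :=
    PresentedGroup.mk_eq_mk_of_mul_inv_mem (by simp [binaryOctahedralRels])
  have hr' : x 0 = x 1 * x 2 := by
    rw [sq, mul_assoc] at hr
    exact mul_left_cancel hr
  have h₁ : x 2 * x 1 * x 2 = x 1 ^ 2 := by
    apply mul_left_cancel (a := x 1)
    rw [← pow_succ', hs, hr']
    group
  have h₂ : x 1 * x 2 * x 1 = x 2 ^ 3 := by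
    apply mul_right_cancel (b := x 2)
    rw [← pow_succ, ht, hr']
  have hgen : Subgroup.closure {x 1, x 2} = ⊤ := by
    have hmem₁ : x 1 ∈ Subgroup.closure {x 1, x 2} := Subgroup.subset_closure (by simp)
    have hmem₂ : x 2 ∈ Subgroup.closure {x 1, x 2} := Subgroup.subset_closure (by simp)
    rw [eq_top_iff]
    rintro g -
    apply PresentedGroup.generated_by
    intro i
    fin_cases i
    · change x 0 ∈ _
      rw [hr']
      exact mul_mem hmem₁ hmem₂
    · exact hmem₁
    · exact hmem₂
  have hinj : Function.Injective (normalForm (x 1) (x 2)) := by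
    let φ := PresentedGroup.toGroup perm_relations
    have hφ₁ : φ (x 1) = permS := PresentedGroup.toGroup.of perm_relations
    have hφ₂ : φ (x 2) = permT := PresentedGroup.toGroup.of perm_relations
    have hφ (p) : φ (normalForm (x 1) (x 2) p) = normalForm permS permT p := by
      obtain ⟨c, k⟩ := p
      fin_cases c <;> simp [normalForm, cosetRep, hφ₁, hφ₂]
    intro p q h
    apply injective_perm
    simp only [← hφ, h]
  have hbij : Function.Bijective (normalForm (x 1) (x 2)) :=
    ⟨hinj, normalForm_surjective h₁ h₂ hgen⟩
  exact ⟨.of_surjective _ hbij.2, by simp [← Nat.card_congr (Equiv.ofBijective _ hbij)]⟩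
end

section
/- The binary icosahedral group has order 120: the group presented by three generators r, s, t subject to the relations r² = s³ = t⁵ = r·s·t (i.e., with relators r²(rst)⁻¹, s³(rst)⁻¹, t⁵(rst)⁻¹) is a finite group of order 120. -/
/-- The relators `r²(rst)⁻¹`, `s³(rst)⁻¹`, `t⁵(rst)⁻¹` of the binary icosahedral group,
where `r`, `s`, `t` are the three generators of the free group on `Fin 3`.  The group
presented by these relators satisfies `r² = s³ = t⁵ = rst`, and the common value is not
required to be the identity. -/
def binaryIcosahedralRels : Set (FreeGroup (Fin 3)) :=
  { FreeGroup.of 0 ^ 2 * (FreeGroup.of 0 * FreeGroup.of 1 * FreeGroup.of 2)⁻¹,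
    FreeGroup.of 1 ^ 3 * (FreeGroup.of 0 * FreeGroup.of 1 * FreeGroup.of 2)⁻¹,
    FreeGroup.of 2 ^ 5 * (FreeGroup.of 0 * FreeGroup.of 1 * FreeGroup.of 2)⁻¹ }

namespace BinaryIcosahedral

/-- Representatives for the right cosets of `⟨t⟩` in the binary icosahedral group. -/
def cosetRep {G : Type*} [Monoid G] (s t : G) : Fin 12 → G :=
  ![1, s, s * t, s * t ^ 2, s * t ^ 3, s * t ^ 4,
    s * t ^ 3 * s, s * t ^ 3 * s * t, s * t ^ 3 * s * t ^ 2, s * t ^ 3 * s * t ^ 3,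
    s * t ^ 3 * s * t ^ 4, s * t ^ 3 * s * t ^ 4 * s]

/-- The word `t ^ k * w`, where `w` is the `i`-th coset representative. -/
def normalForm {G : Type*} [Monoid G] (s t : G) (p : Fin 10 × Fin 12) : G :=
  t ^ (p.1 : ℕ) * cosetRep s t p.2

lemma map_normalForm {G H : Type*} [Monoid G] [Monoid H] (f : G →* H) (s t : G)
    (p : Fin 10 × Fin 12) : f (normalForm s t p) = normalForm (f s) (f t) p := by
  obtain ⟨k, i⟩ := p
  fin_cases i <;> simp [normalForm, cosetRep]

section Relations

variable {G : Type*} [Group G] {s t : G}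

lemma commute_pow_five (hs : s ^ 3 = t ^ 5) : Commute s (t ^ 5) :=
  hs ▸ Commute.self_pow s 3

lemma mul_mul_eq_pow_four (hst : s * t * (s * t) = t ^ 5) : s * t * s = t ^ 4 :=
  mul_right_cancel (b := t) (by rw [← pow_succ, ← hst]; group)

lemma mul_mul_eq_sq (hs : s ^ 3 = t ^ 5) (hst : s * t * (s * t) = t ^ 5) :
    t * s * t = s ^ 2 :=
  mul_left_cancel (a := s) (by rw [← pow_succ', hs, ← hst]; group)

lemma mul_sq_mul (hs : s ^ 3 = t ^ 5) (hst : s * t * (s * t) = t ^ 5) :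
    t * (s * t ^ 2 * s) = s * t ^ 4 := by
  calc t * (s * t ^ 2 * s) = t * s * t * t * s := by simp only [pow_succ, pow_zero, one_mul, mul_assoc]
    _ = s * (s * t * s) := by rw [mul_mul_eq_sq hs hst]; simp only [pow_two, mul_assoc]
    _ = s * t ^ 4 := by rw [mul_mul_eq_pow_four hst]

lemma mul_pow_four_mul (hs : s ^ 3 = t ^ 5) (hst : s * t * (s * t) = t ^ 5) :
    s * t ^ 4 * s = t * (s * t ^ 3 * s * t) := by
  calc s * t ^ 4 * s = s ^ 2 * t * s ^ 2 := by
        rw [← mul_mul_eq_pow_four hst]; simp only [pow_two, mul_assoc]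
    _ = t * (s * t ^ 3 * s * t) := by
        rw [← mul_mul_eq_sq hs hst]; simp only [pow_succ, pow_zero, one_mul, mul_assoc]

lemma mul_pow_three_mul_mul (hs : s ^ 3 = t ^ 5) (hst : s * t * (s * t) = t ^ 5) :
    s * t ^ 3 * s * s = t * (s * t ^ 3 * s * t ^ 2) := by
  calc s * t ^ 3 * s * s = s * t ^ 3 * s ^ 2 := by simp only [pow_two, mul_assoc]
    _ = s * t ^ 4 * s * t := by
        rw [← mul_mul_eq_sq hs hst]; simp only [pow_succ, pow_zero, one_mul, mul_assoc]
    _ = t * (s * t ^ 3 * s * t ^ 2) := by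
        rw [mul_pow_four_mul hs hst]; simp only [pow_two, mul_assoc]

/-- The representative `u = s t³ s t⁴ s` satisfies `t u t = u`. -/
lemma mul_longRep_mul (hs : s ^ 3 = t ^ 5) (hst : s * t * (s * t) = t ^ 5) :
    t * (s * t ^ 3 * s * t ^ 4 * s) * t = s * t ^ 3 * s * t ^ 4 * s := by
  symm
  calc s * t ^ 3 * s * t ^ 4 * s = s * t ^ 3 * s ^ 2 * t * s ^ 2 := by
        rw [← mul_mul_eq_pow_four hst]; simp only [pow_two, mul_assoc]
    _ = s * t ^ 4 * s * t ^ 3 * s * t := by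
        rw [← mul_mul_eq_sq hs hst]; simp only [pow_succ, pow_zero, one_mul, mul_assoc]
    _ = t * (s * t ^ 3 * s * t ^ 4 * s) * t := by
        rw [mul_pow_four_mul hs hst]; simp only [pow_succ, pow_zero, one_mul, mul_assoc]

lemma pow_ten_eq_one (hs : s ^ 3 = t ^ 5) (hst : s * t * (s * t) = t ^ 5) : t ^ 10 = 1 := by
  have hu := mul_longRep_mul hs hst
  have hc : Commute (s * t ^ 3 * s * t ^ 4 * s) (t ^ 5) := by
    have h1 := commute_pow_five hs
    have h2 : ∀ n, Commute (t ^ n) (t ^ 5) := fun n => Commute.pow_pow_self t n 5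
    exact (((h1.mul_left (h2 3)).mul_left h1).mul_left (h2 4)).mul_left h1
  generalize s * t ^ 3 * s * t ^ 4 * s = u at hu hc
  have h5 : t ^ 5 * u * t ^ 5 = u := by
    calc t ^ 5 * u * t ^ 5 = t * (t * (t * (t * (t * u * t) * t) * t) * t) * t := by
          simp only [pow_succ, pow_zero, one_mul, mul_assoc]
      _ = u := by simp only [hu]
  rw [mul_assoc, hc.eq, ← mul_assoc, ← pow_add] at h5
  exact mul_eq_right.mp h5

lemma mem_range_normalForm (ht : t ^ 10 = 1) (k : ℕ) (i : Fin 12) :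
    t ^ k * cosetRep s t i ∈ Set.range (normalForm s t) :=
  ⟨(⟨k % 10, Nat.mod_lt _ (by norm_num)⟩, i), by
    simp only [normalForm, ← pow_eq_pow_mod k ht]⟩

lemma range_normalForm_mul_right (ht : t ^ 10 = 1) {x : G}
    (h : ∀ i, ∃ k : ℕ, ∃ j, cosetRep s t i * x = t ^ k * cosetRep s t j)
    {g : G} (hg : g ∈ Set.range (normalForm s t)) : g * x ∈ Set.range (normalForm s t) := by
  obtain ⟨⟨m, i⟩, rfl⟩ := hg
  obtain ⟨k, j, hk⟩ := h i
  rw [normalForm, mul_assoc, hk, ← mul_assoc, ← pow_add]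
  exact mem_range_normalForm ht _ _

lemma eq_pow_nine_mul (ht : t ^ 10 = 1) {x y : G} (h : t * x = y) : x = t ^ 9 * y := by
  rw [← h, ← mul_assoc, ← pow_succ, ht, one_mul]

lemma cosetRep_mul_t (hs : s ^ 3 = t ^ 5) (hst : s * t * (s * t) = t ^ 5) (i : Fin 12) :
    ∃ k : ℕ, ∃ j, cosetRep s t i * t = t ^ k * cosetRep s t j := by
  have ht := pow_ten_eq_one hs hst
  have hc := commute_pow_five hs
  have hc' : Commute (s * t ^ 3 * s) (t ^ 5) :=
    (hc.mul_left (Commute.pow_pow_self t 3 5)).mul_left hc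
  have hu := eq_pow_nine_mul ht ((mul_assoc _ _ _).symm.trans (mul_longRep_mul hs hst))
  fin_cases i
  · exact ⟨1, 0, by simp [cosetRep]⟩
  · exact ⟨0, 2, by simp [cosetRep]⟩
  · exact ⟨0, 3, by simp [cosetRep, pow_succ, mul_assoc]⟩
  · exact ⟨0, 4, by simp [cosetRep, pow_succ, mul_assoc]⟩
  · exact ⟨0, 5, by simp [cosetRep, pow_succ, mul_assoc]⟩
  · exact ⟨5, 1, by simpa [cosetRep, pow_succ, mul_assoc] using hc.eq⟩
  · exact ⟨0, 7, by simp [cosetRep]⟩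
  · exact ⟨0, 8, by simp [cosetRep, pow_succ, mul_assoc]⟩
  · exact ⟨0, 9, by simp [cosetRep, pow_succ, mul_assoc]⟩
  · exact ⟨0, 10, by simp [cosetRep, pow_succ, mul_assoc]⟩
  · exact ⟨5, 6, by simpa [cosetRep, pow_succ, mul_assoc] using hc'.eq⟩
  · exact ⟨9, 11, hu⟩

lemma cosetRep_mul_s (hs : s ^ 3 = t ^ 5) (hst : s * t * (s * t) = t ^ 5) (i : Fin 12) :
    ∃ k : ℕ, ∃ j, cosetRep s t i * s = t ^ k * cosetRep s t j := by
  have ht := pow_ten_eq_one hs hst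
  have hs5 := commute_pow_five hs
  have ht5 : ∀ n, Commute (t ^ n) (t ^ 5) := fun n => Commute.pow_pow_self t n 5
  have cube : ∀ x : G, Commute x (t ^ 5) → x * s * s * s = t ^ 5 * x := fun x hx => by
    rw [← hx.eq, ← hs]; simp only [pow_succ, pow_zero, one_mul, mul_assoc]
  have h3 := eq_pow_nine_mul ht (mul_sq_mul hs hst)
  have h5 := mul_pow_four_mul hs hst
  have h6 := mul_pow_three_mul_mul hs hst
  have h7 : s * t ^ 3 * s * t * s = t ^ 5 * (s * t ^ 2) := by
    rw [← cube _ (hs5.mul_left (ht5 2))]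
    apply mul_left_cancel (a := t)
    rw [← mul_assoc, ← h5, ← mul_sq_mul hs hst]
    simp only [mul_assoc]
  have h8 : s * t ^ 3 * s * t ^ 2 * s = t ^ 4 * (s * t ^ 3) := by
    apply mul_left_cancel (a := t)
    rw [← mul_assoc, ← h6, cube _ (hs5.mul_left (ht5 3))]
    simp only [pow_succ, pow_zero, one_mul, mul_assoc]
  have hb : Commute (s * t ^ 3 * s) (t ^ 5) := (hs5.mul_left (ht5 3)).mul_left hs5
  have h11 : s * t ^ 3 * s * t ^ 4 * s * s = t ^ 6 * (s * t ^ 3 * s * t ^ 3) := by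
    calc s * t ^ 3 * s * t ^ 4 * s * s = s * t ^ 3 * s * t ^ 4 * s ^ 2 := by
          simp only [pow_two, mul_assoc]
      _ = s * t ^ 3 * s * t ^ 5 * s * t := by
          rw [← mul_mul_eq_sq hs hst]; simp only [pow_succ, pow_zero, one_mul, mul_assoc]
      _ = t ^ 5 * (s * t ^ 3 * s * s) * t := by rw [hb.eq]; simp only [mul_assoc]
      _ = t ^ 6 * (s * t ^ 3 * s * t ^ 3) := by
          rw [h6]; simp only [pow_succ, pow_zero, one_mul, mul_assoc]
  have h9 : s * t ^ 3 * s * t ^ 3 * s = t ^ 9 * (s * t ^ 3 * s * t ^ 4) := by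
    apply mul_left_cancel (a := t ^ 6)
    rw [← mul_assoc, ← h11, cube _ (hb.mul_left (ht5 4)), ← mul_assoc (t ^ 6), ← pow_add,
      pow_eq_pow_mod (6 + 9) ht]
  fin_cases i
  · exact ⟨0, 1, by simp [cosetRep]⟩
  · exact ⟨1, 2, by simpa [cosetRep, pow_two, mul_assoc] using (mul_mul_eq_sq hs hst).symm⟩
  · exact ⟨4, 0, by simpa [cosetRep] using mul_mul_eq_pow_four hst⟩
  · exact ⟨9, 5, h3⟩
  · exact ⟨0, 6, by simp [cosetRep]⟩
  · exact ⟨1, 7, by simpa [cosetRep] using h5⟩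
  · exact ⟨1, 8, by simpa [cosetRep] using h6⟩
  · exact ⟨5, 3, h7⟩
  · exact ⟨4, 4, h8⟩
  · exact ⟨9, 10, h9⟩
  · exact ⟨0, 11, by simp [cosetRep]⟩
  · exact ⟨6, 9, h11⟩

lemma normalForm_surjective (hs : s ^ 3 = t ^ 5) (hst : s * t * (s * t) = t ^ 5)
    (hgen : Subgroup.closure {s, t} = ⊤) : Function.Surjective (normalForm s t) := by
  have ht := pow_ten_eq_one hs hst
  have hs6 : s ^ 6 = 1 := by rw [show 6 = 3 * 2 from rfl, pow_mul, hs, ← pow_mul, ht]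
  have hmul : ∀ x ∈ ({s, t} : Set G), ∀ g ∈ Set.range (normalForm s t),
      g * x ∈ Set.range (normalForm s t) := by
    rintro x (rfl | rfl) g hg
    · exact range_normalForm_mul_right ht (cosetRep_mul_s hs hst) hg
    · exact range_normalForm_mul_right ht (cosetRep_mul_t hs hst) hg
  have hpow : ∀ x ∈ ({s, t} : Set G), ∀ n : ℕ, ∀ g ∈ Set.range (normalForm s t),
      g * x ^ n ∈ Set.range (normalForm s t) := by
    intro x hx n g hg
    induction n with
    | zero => simpa using hg
    | succ n ih => rw [pow_succ, ← mul_assoc]; exact hmul x hx _ ih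
  have hinv : ∀ x ∈ ({s, t} : Set G), ∃ n : ℕ, x⁻¹ = x ^ n := by
    rintro x (rfl | rfl)
    · exact ⟨5, inv_eq_of_mul_eq_one_left (by rw [← pow_succ, hs6])⟩
    · exact ⟨9, inv_eq_of_mul_eq_one_left (by rw [← pow_succ, ht])⟩
  intro g
  have hg : g ∈ Subgroup.closure {s, t} := hgen ▸ Subgroup.mem_top g
  induction hg using Subgroup.closure_induction_right with
  | one => exact ⟨(0, 0), by simp [normalForm, cosetRep]⟩
  | mul_right x _ y hy ih => exact hmul y hy x ih
  | mul_inv_cancel x _ y hy ih =>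
    obtain ⟨n, hn⟩ := hinv y hy
    rw [hn]
    exact hpow y hy n x ih

end Relations

/-- The image of `s` in `SL(2, 5)`. -/
def matS : Matrix.SpecialLinearGroup (Fin 2) (ZMod 5) := ⟨!![0, 1; -1, 1], by decide⟩

/-- The image of `t` in `SL(2, 5)`. -/
def matT : Matrix.SpecialLinearGroup (Fin 2) (ZMod 5) := ⟨!![-1, -1; 0, -1], by decide⟩

lemma normalForm_mat_injective : Function.Injective (normalForm matS matT) := by
  decide +kernel

/-- The homomorphism from the binary icosahedral group to `SL(2, 5)`. -/
def toSL : PresentedGroup binaryIcosahedralRels →* Matrix.SpecialLinearGroup (Fin 2) (ZMod 5) :=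
  PresentedGroup.toGroup (f := ![matS * matT, matS, matT]) (by
    rintro x (rfl | rfl | rfl) <;> simp <;> decide +kernel)

end BinaryIcosahedral

open BinaryIcosahedral in
/-- The binary icosahedral group `⟨r,s,t ∣ r² = s³ = t⁵ = rst⟩` is a finite group of
order `120`. -/
theorem binaryIcosahedral_card :
    Finite (PresentedGroup binaryIcosahedralRels) ∧
    Nat.card (PresentedGroup binaryIcosahedralRels) = 120 := by
  let r : PresentedGroup binaryIcosahedralRels := PresentedGroup.of 0
  let s : PresentedGroup binaryIcosahedralRels := PresentedGroup.of 1
  let t : PresentedGroup binaryIcosahedralRels := PresentedGroup.of 2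
  have h1 : r ^ 2 = r * s * t := mul_inv_eq_one.mp
    (PresentedGroup.one_of_mem (rels := binaryIcosahedralRels) (.inl rfl))
  have h2 : s ^ 3 = r * s * t := mul_inv_eq_one.mp
    (PresentedGroup.one_of_mem (rels := binaryIcosahedralRels) (.inr (.inl rfl)))
  have h3 : t ^ 5 = r * s * t := mul_inv_eq_one.mp
    (PresentedGroup.one_of_mem (rels := binaryIcosahedralRels) (.inr (.inr rfl)))
  have hr : r = s * t := by rwa [pow_two, mul_assoc, mul_right_inj] at h1
  have hgen : Subgroup.closure {s, t} = ⊤ := by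
    rw [eq_top_iff, ← PresentedGroup.closure_range_of, Subgroup.closure_le]
    have hs : s ∈ Subgroup.closure {s, t} := Subgroup.subset_closure (by simp)
    have ht : t ∈ Subgroup.closure {s, t} := Subgroup.subset_closure (by simp)
    rintro _ ⟨i, rfl⟩
    fin_cases i
    · exact (congrArg (· ∈ Subgroup.closure {s, t}) hr).mpr (mul_mem hs ht)
    · exact hs
    · exact ht
  have hsurj : Function.Surjective (normalForm s t) :=
    normalForm_surjective (h2.trans h3.symm) (by rw [h3, hr, mul_assoc (s * t)]) hgen
  have hinj : Function.Injective (normalForm s t) := by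
    refine Function.Injective.of_comp (f := toSL) ?_
    have : toSL ∘ normalForm s t = normalForm matS matT := by
      ext1 p
      simp [map_normalForm, toSL, s, t]
    exact this ▸ normalForm_mat_injective
  refine ⟨Finite.of_surjective _ hsurj, ?_⟩
  rw [← Nat.card_eq_of_bijective _ ⟨hinj, hsurj⟩]
  simp
end

section
/- Row sums of irreducible characters are nonnegative integers: let G be a finite group and let χ be the character of a complex irreducible representation of G. Then the sum of χ over a set of representatives of the conjugacy classes of G, ∑_{c ∈ ConjClasses(G)} χ(g_c), is a nonnegative integer (it equals the multiplicity of that irreducible representation in the conjugation representation of G on ℂ^G). -/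
open CategoryTheory

open Representation in
/-- The character of a permutation representation counts fixed points. -/
theorem Representation.character_ofMulAction {k G X : Type*} [Field k] [Group G] [MulAction G X]
    [Finite X] (g : G) :
    (ofMulAction k G X).character g = Nat.card (MulAction.fixedBy X g) := by
  classical
  have := Fintype.ofFinite X
  let b : Module.Basis X k (MonoidAlgebra k X) := .ofRepr (MonoidAlgebra.coeffLinearEquiv k)
  have hb (x : X) : b x = MonoidAlgebra.single x 1 := rfl
  have hrepr (v : MonoidAlgebra k X) : b.repr v = v.coeff := rfl
  rw [character, LinearMap.trace_eq_matrix_trace k b, Matrix.trace]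
  simp [LinearMap.toMatrix_apply, hb, hrepr, Finsupp.single_apply, Nat.card_eq_fintype_card,
    Fintype.card_subtype, MulAction.mem_fixedBy]

/-- The conjugation representation of `G`, that is, the permutation representation attached to
the action of `G` on itself by conjugation. -/
noncomputable def Representation.conjugation (k G : Type*) [CommSemiring k] [Group G] :
    Representation k G (MonoidAlgebra k G) :=
  (ofMulAction k (ConjAct G) G).comp ConjAct.toConjAct.toMonoidHom

/-- The orbit-stabilizer theorem for the conjugation action. -/
theorem ConjClasses.card_carrier_mul_card_fixedBy {G : Type*} [Group G] (g : G) :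
    Nat.card (ConjClasses.mk g).carrier *
      Nat.card (MulAction.fixedBy G (ConjAct.toConjAct g)) = Nat.card G := by
  have hfix : Nat.card (MulAction.fixedBy G (ConjAct.toConjAct g)) =
      Nat.card (MulAction.stabilizer (ConjAct G) g) := by
    refine Nat.card_congr (ConjAct.toConjAct.toEquiv.subtypeEquiv fun h => ?_)
    simp [ConjAct.smul_def, mul_inv_eq_iff_eq_mul, eq_comm (a := g * h)]
  rw [hfix, ← ConjAct.orbit_eq_carrier_conjClasses, ← Nat.card_prod,
    Nat.card_congr (MulAction.orbitProdStabilizerEquivGroup (ConjAct G) g)]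
  exact Nat.card_congr ConjAct.ofConjAct.toEquiv

theorem Representation.character_conjugation (k : Type*) {G : Type*} [Field k] [Group G] [Finite G]
    (g : G) : (conjugation k G).character g =
      Nat.card (MulAction.fixedBy G (ConjAct.toConjAct g)) :=
  character_ofMulAction (k := k) (ConjAct.toConjAct g)

/-- Pairing a class function with the conjugation character sums it over the conjugacy classes. -/
theorem Representation.sum_mul_character_conjugation {k G : Type*} [Field k] [CharZero k] [Group G]
    [Fintype G] [Fintype (ConjClasses G)] (f : G → k)
    (hf : ∀ g h, IsConj g h → f g = f h) :
    ∑ g, f g * (conjugation k G).character g⁻¹ =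
      Nat.card G * ∑ c : ConjClasses G, f (Quotient.out c) := by
  classical
  rw [← Finset.sum_fiberwise (s := Finset.univ) (g := ConjClasses.mk), Finset.mul_sum]
  refine Finset.sum_congr rfl fun c _ => ?_
  have hcard : Nat.card c.carrier = (Finset.univ.filter fun g => ConjClasses.mk g = c).card := by
    rw [← Fintype.card_subtype, ← Nat.card_eq_fintype_card]
    exact Nat.card_congr (.subtypeEquivRight fun _ => ConjClasses.mem_carrier_iff_mk_eq)
  have hne : (Nat.card c.carrier : k) ≠ 0 := by
    obtain ⟨g, rfl⟩ := ConjClasses.exists_rep c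
    have := ConjClasses.card_carrier_mul_card_fixedBy g
    exact Nat.cast_ne_zero.mpr (left_ne_zero_of_mul (this.trans_ne Nat.card_pos.ne'))
  have hterm : ∀ g ∈ Finset.univ.filter fun g => ConjClasses.mk g = c,
      f g * (conjugation k G).character g⁻¹ =
        Nat.card G / Nat.card c.carrier * f (Quotient.out c) := by
    intro g hg
    obtain rfl : ConjClasses.mk g = c := (Finset.mem_filter.mp hg).2
    have hout : f (Quotient.out (ConjClasses.mk g)) = f g :=
      hf _ _ (ConjClasses.mk_eq_mk_iff_isConj.mp (Quotient.out_eq (ConjClasses.mk g)))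
    rw [hout, character_conjugation, map_inv, MulAction.fixedBy_inv,
      ← ConjClasses.card_carrier_mul_card_fixedBy g]
    push_cast
    field_simp
  rw [Finset.sum_congr rfl hterm, Finset.sum_const, ← hcard, nsmul_eq_mul]
  field_simp

/-- Row sums of irreducible characters are nonnegative integers: for a finite group `G`
and the character `χ` of a complex irreducible representation `V` of `G`, the sum of `χ`
over a set of representatives of the conjugacy classes of `G` is a nonnegative integer
(namely, the multiplicity of `V` in the conjugation representation of `G` on `ℂ^G`). -/
theorem irreducible_character_row_sum_nonneg_int
    (G : Type) [Group G] [Finite G] (V : FDRep ℂ G) [Simple V] :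
    ∃ n : ℕ, ∑ᶠ c : ConjClasses G, V.character (Quotient.out c) = (n : ℂ) := by
  have := Fintype.ofFinite G
  have := Fintype.ofFinite (ConjClasses G)
  have hG : (Nat.card G : ℂ) ≠ 0 := Nat.cast_ne_zero.mpr Nat.card_pos.ne'
  have := invertibleOfNonzero hG
  have : FiniteDimensional ℂ (MonoidAlgebra ℂ G) :=
    .of_injective (MonoidAlgebra.coeffLinearEquiv ℂ).toLinearMap
      (MonoidAlgebra.coeffLinearEquiv ℂ).injective
  have hclass (g h : G) (hgh : IsConj g h) : V.character g = V.character h := by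
    obtain ⟨x, rfl⟩ := isConj_iff.mp hgh
    exact (V.char_conj g x).symm
  refine ⟨Module.finrank ℂ
    (Representation.IntertwiningMap (Representation.conjugation ℂ G) V.ρ), ?_⟩
  rw [finsum_eq_sum_of_fintype,
    ← Representation.card_inv_mul_sum_char_mul_char_eq_finrank, eq_inv_mul_iff_mul_eq₀ hG]
  exact (Representation.sum_mul_character_conjugation V.character hclass).symm
end
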